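/- arXiv:math/0611659 — 2 statements merged into one kernel-verified Lean document; each statement's English description precedes it below -/
import Mathlib

section
/- Let w(x) = Σ_{n≥1} n^{n-1} x^n / n! be the tree series satisfying w = x e^w. Then 1/(1 - w(x)) = Σ_{n≥0} n^n x^n / n! as formal power series. -/
/-- The tree series `w(x) = ∑_{n≥1} n^{n-1} x^n / n!` in `ℚ[[x]]`
(the unique solution with zero constant term of `w = x e^w`). -/
noncomputable def treeSeries : PowerSeries ℚ :=
  PowerSeries.mk fun n =>
    if n = 0 then 0 else (n : ℚ) ^ (n - 1) / (Nat.factorial n : ℚ)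

open Finset in
/-- The binomial theorem, with divided powers. -/
theorem add_pow_div_factorial_eq_sum_antidiagonal (a b : ℚ) (n : ℕ) :
    (a + b) ^ n / (n.factorial : ℚ) =
      ∑ p ∈ antidiagonal n, a ^ p.1 / (p.1.factorial : ℚ) * (b ^ p.2 / (p.2.factorial : ℚ)) := by
  rw [(Commute.all a b).add_pow', sum_div]
  refine sum_congr rfl fun p hp => ?_
  obtain rfl := mem_antidiagonal.mp hp
  rw [nsmul_eq_mul, Nat.cast_add_choose]
  field_simp

open Finset in
/-- The alternating sum `∑ (-1)^(m-k) (m choose k) k^(m-1) / m!` over `1 ≤ k ≤ m`, an `m`-th forward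
difference of a power of degree `m - 1`, vanishes unless `m = 1`. -/
theorem sum_antidiagonal_coeff_treeSeries_mul_neg_pow (m : ℕ) :
    ∑ p ∈ antidiagonal m,
        PowerSeries.coeff p.1 treeSeries * ((-(p.1 : ℚ)) ^ p.2 / (p.2.factorial : ℚ)) =
      if m = 1 then 1 else 0 := by
  rcases Nat.lt_or_ge m 2 with hm | hm
  · interval_cases m <;> simp [treeSeries, Nat.sum_antidiagonal_succ]
  have hdiff := congrFun (fwdDiff_iter_pow_eq_zero_of_lt (R := ℚ) (by lia : m - 1 < m)) 0
  rw [fwdDiff_iter_eq_sum_shift] at hdiff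
  rw [if_neg (by lia), Nat.sum_antidiagonal_eq_sum_range_succ_mk,
    ← zero_div (m.factorial : ℚ), ← Pi.zero_apply (M := fun _ : ℚ => ℚ) 0, ← hdiff, sum_div]
  refine sum_congr rfl fun k hk => ?_
  have hkm : k ≤ m := Nat.lt_succ_iff.mp (mem_range.mp hk)
  rcases Nat.eq_zero_or_pos k with rfl | hk0
  · simp [treeSeries, zero_pow (by lia : m - 1 ≠ 0)]
  have hpow : (k : ℚ) ^ (m - 1) = (k : ℚ) ^ (k - 1) * (k : ℚ) ^ (m - k) := by
    rw [← pow_add]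
    congr 1
    lia
  simp only [treeSeries, PowerSeries.coeff_mk, if_neg hk0.ne', zero_add, nsmul_eq_mul, mul_one,
    zsmul_eq_mul, hpow]
  push_cast
  rw [Nat.cast_choose ℚ hkm, neg_pow]
  field_simp

open Finset in
/-- An instance of Abel's binomial identity, in terms of the tree series. -/
theorem sum_antidiagonal_coeff_treeSeries_mul_pow {n : ℕ} (hn : n ≠ 0) :
    ∑ p ∈ antidiagonal n,
        PowerSeries.coeff p.1 treeSeries * ((p.2 : ℚ) ^ p.2 / (p.2.factorial : ℚ)) =
      (n : ℚ) ^ n / (n.factorial : ℚ) := by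
  calc
    _ = ∑ p ∈ antidiagonal n, ∑ q ∈ antidiagonal p.2,
          PowerSeries.coeff p.1 treeSeries * ((-(p.1 : ℚ)) ^ q.1 / (q.1.factorial : ℚ) *
            ((n : ℚ) ^ q.2 / (q.2.factorial : ℚ))) := by
      refine sum_congr rfl fun p hp => ?_
      rw [← mul_sum, ← add_pow_div_factorial_eq_sum_antidiagonal, ← mem_antidiagonal.mp hp]
      push_cast
      rw [neg_add_cancel_left]
    _ = ∑ q ∈ antidiagonal n, ∑ p ∈ antidiagonal q.1,
          PowerSeries.coeff p.1 treeSeries * ((-(p.1 : ℚ)) ^ p.2 / (p.2.factorial : ℚ) *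
            ((n : ℚ) ^ q.2 / (q.2.factorial : ℚ))) := by
      rw [sum_sigma', sum_sigma']
      refine sum_nbij' (fun ⟨⟨i, _⟩, ⟨k, l⟩⟩ => ⟨(i + k, l), (i, k)⟩)
        (fun ⟨⟨_, j⟩, ⟨k, l⟩⟩ => ⟨(k, l + j), (l, j)⟩) ?_ ?_ ?_ ?_ ?_ <;>
        simp +contextual [add_assoc]
      intros
      lia
    _ = ∑ q ∈ antidiagonal n,
          (if q.1 = 1 then 1 else 0) * ((n : ℚ) ^ q.2 / (q.2.factorial : ℚ)) := by
      refine sum_congr rfl fun q _ => ?_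
      rw [← sum_antidiagonal_coeff_treeSeries_mul_neg_pow, sum_mul]
      simp only [mul_assoc]
    _ = (n : ℚ) ^ n / (n.factorial : ℚ) := by
      obtain ⟨n, rfl⟩ := Nat.exists_eq_succ_of_ne_zero hn
      rw [Nat.sum_antidiagonal_eq_sum_range_succ_mk,
        sum_eq_single_of_mem 1 (by simp) fun k _ hk => by simp [hk]]
      simp only [if_true, one_mul, Nat.succ_eq_add_one, Nat.add_sub_cancel, Nat.factorial_succ,
        pow_succ]
      push_cast
      field_simp

/-- `1/(1 - w(x)) = ∑_{n≥0} n^n x^n / n!` as formal power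
series, stated as: `∑_{n≥0} n^n x^n/n!` is the multiplicative inverse of
`1 - w(x)` (which exists since `1 - w` has constant term `1`). -/
theorem one_sub_treeSeries_inverse :
    (PowerSeries.mk fun n => (n : ℚ) ^ n / (Nat.factorial n : ℚ)) *
      (1 - treeSeries) = 1 := by
  rw [mul_sub, mul_one, mul_comm]
  ext n
  rw [map_sub, PowerSeries.coeff_mul, PowerSeries.coeff_one]
  simp only [PowerSeries.coeff_mk]
  rcases eq_or_ne n 0 with rfl | hn
  · simp [treeSeries]
  · rw [sum_antidiagonal_coeff_treeSeries_mul_pow hn, sub_self, if_neg hn]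
end

section
/- Let α = (α_1, …, α_n) be a partition of d with n parts. Then the genus 0 single Hurwitz number satisfies H^0_α = (d - 2 + n)! · d^{n-3} · Π_{i=1}^n (α_i^{α_i} / α_i!). -/
section

open Finset

/-- Finite differences of order `#I` kill monomials of degree less than `#I`. -/
theorem sum_powerset_neg_one_pow_mul_pow {ι : Type*} [DecidableEq ι] (α : ι → ℚ) (I : Finset ι) :
    ∀ (p : ℕ) (x : ℚ), p < #I → ∑ S ∈ I.powerset, (-1) ^ #S * (x + ∑ i ∈ S, α i) ^ p = 0 := by
  induction I using Finset.induction_on with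
  | empty => simp
  | insert j I hj ih =>
    intro p x hp
    rw [card_insert_of_notMem hj] at hp
    rw [sum_powerset_insert hj, ← sum_add_distrib]
    have key : ∀ S ∈ I.powerset, (-1) ^ #S * (x + ∑ i ∈ S, α i) ^ p +
        (-1) ^ #(insert j S) * (x + ∑ i ∈ insert j S, α i) ^ p =
        - ∑ q ∈ range p, ((-1) ^ #S * (x + ∑ i ∈ S, α i) ^ q) * (α j ^ (p - q) * p.choose q) := by
      intro S hS
      have hjS : j ∉ S := fun h => hj (mem_powerset.1 hS h)
      rw [card_insert_of_notMem hjS, sum_insert hjS, add_left_comm, add_comm (α j)]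
      generalize x + ∑ i ∈ S, α i = y
      rw [add_pow y, sum_range_succ, pow_succ, mul_add, mul_sum, ← sum_neg_distrib, add_comm,
        add_assoc]
      simp only [Nat.sub_self, pow_zero, Nat.choose_self, Nat.cast_one, mul_one, mul_neg, neg_mul,
        neg_add_cancel, add_zero]
      exact sum_congr rfl fun q _ => by ring
    rw [sum_congr rfl key, sum_neg_distrib, sum_comm, neg_eq_zero]
    refine sum_eq_zero fun q hq => ?_
    rw [← sum_mul, ih q x (by have := mem_range.1 hq; omega), zero_mul]

/-- The Hurwitz polynomial `x (x + α(S))^(|S| - 1)`. -/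
def hurwitzPoly {ι : Type*} (α : ι → ℚ) (x : ℚ) (S : Finset ι) : ℚ :=
  x * (x + ∑ i ∈ S, α i) ^ ((#S : ℤ) - 1)

theorem add_sum_pos {ι : Type*} {α : ι → ℚ} (hα : ∀ i, 0 ≤ α i) {x : ℚ} (hx : 0 < x)
    (S : Finset ι) :
    0 < x + ∑ i ∈ S, α i :=
  add_pos_of_pos_of_nonneg hx (sum_nonneg fun i _ => hα i)

section HurwitzPoly

variable {ι : Type*} [DecidableEq ι] {α : ι → ℚ}

theorem sum_hurwitzPoly_mul_pow (hα : ∀ i, 0 ≤ α i) {x : ℚ} (hx : 0 < x) (y : ℚ) (I : Finset ι) :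
    ∑ S ∈ I.powerset, hurwitzPoly α x S * (y + ∑ i ∈ I \ S, α i) ^ #(I \ S) =
      (x + y + ∑ i ∈ I, α i) ^ #I := by
  have h1 : ∀ S ∈ I.powerset, hurwitzPoly α x S * (y + ∑ i ∈ I \ S, α i) ^ #(I \ S) =
      ∑ R ∈ (I \ S).powerset, hurwitzPoly α x S * ((x + y + ∑ i ∈ I, α i) ^ #R *
        (-(x + ∑ i ∈ S, α i)) ^ (#(I \ S) - #R)) := by
    intro S hS
    rw [← mul_sum, Finset.sum_pow_mul_eq_add_pow, ← sum_sdiff (mem_powerset.1 hS)]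
    congr 2
    ring
  rw [sum_congr rfl h1, sum_comm' (t' := I.powerset) (s' := fun R => (I \ R).powerset)]
  · rw [sum_eq_single I]
    · simp [hurwitzPoly, hx.ne']
    · intro R hR hRI
      have hlt : #R < #I :=
        card_lt_card (lt_of_le_of_ne (mem_powerset.1 hR) hRI)
      have hcard : #(I \ R) = #I - #R := card_sdiff_of_subset (mem_powerset.1 hR)
      have : ∀ S ∈ (I \ R).powerset, hurwitzPoly α x S * ((x + y + ∑ i ∈ I, α i) ^ #R *
        (-(x + ∑ i ∈ S, α i)) ^ (#(I \ S) - #R)) =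
          (x * (x + y + ∑ i ∈ I, α i) ^ #R * (-1) ^ #(I \ R)) *
            ((-1) ^ #S * (x + ∑ i ∈ S, α i) ^ (#(I \ R) - 1)) := by
        intro S hS
        have hS' := mem_powerset.1 hS
        have h2 : #S ≤ #(I \ R) := card_le_card hS'
        have h3 : #(I \ S) - #R = #(I \ R) - #S := by
          rw [card_sdiff_of_subset (hS'.trans sdiff_subset), hcard]; omega
        have h4 := (add_sum_pos hα hx S).ne'
        rw [h3, neg_pow, hurwitzPoly]
        have h5 : (x + ∑ i ∈ S, α i) ^ ((#S : ℤ) - 1) * (x + ∑ i ∈ S, α i) ^ (#(I \ R) - #S) =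
            (x + ∑ i ∈ S, α i) ^ (#(I \ R) - 1) := by
          rw [← zpow_natCast, ← zpow_natCast, ← zpow_add₀ h4]
          congr 1
          omega
        have h6 : (-1 : ℚ) ^ (#(I \ R) - #S) = (-1) ^ #(I \ R) * (-1) ^ #S := by
          have : (-1 : ℚ) ^ #S * (-1) ^ #S = 1 := by rw [← mul_pow]; simp
          rw [← mul_right_inj' (pow_ne_zero #S (show (-1 : ℚ) ≠ 0 by norm_num)), ← pow_add,
            Nat.add_sub_cancel' h2]
          linear_combination -(-1 : ℚ) ^ #(I \ R) * this
        rw [← h5, h6]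
        ring
      rw [sum_congr rfl this, ← mul_sum, sum_powerset_neg_one_pow_mul_pow, mul_zero]
      omega
    · simp
  · intro S R
    simp only [mem_powerset, subset_sdiff]
    constructor
    · rintro ⟨h1, h2, h3⟩; exact ⟨⟨h1, h3.symm⟩, h2⟩
    · rintro ⟨⟨h1, h3⟩, h2⟩; exact ⟨h1, h2, h3.symm⟩

theorem sum_powerset_sum_mem {M : Type*} [AddCommMonoid M] (I : Finset ι)
    (G : ι → Finset ι → Finset ι → M) :
    ∑ S ∈ I.powerset, ∑ j ∈ S, G j (S.erase j) (I \ S) =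
      ∑ j ∈ I, ∑ S ∈ (I.erase j).powerset, G j S ((I.erase j) \ S) := by
  rw [sum_comm' (t' := I) (s' := fun j => I.powerset.filter (j ∈ ·))]
  · refine sum_congr rfl fun j hj => ?_
    refine sum_bij' (fun S _ => S.erase j) (fun S _ => insert j S) ?_ ?_ ?_ ?_ ?_
    · intro S hS
      simp only [mem_filter, mem_powerset] at hS ⊢
      exact erase_subset_erase _ hS.1
    · intro S hS
      simp only [mem_filter, mem_powerset] at hS ⊢
      exact ⟨insert_subset hj (hS.trans (erase_subset _ _)), mem_insert_self _ _⟩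
    · intro S hS
      exact insert_erase (mem_filter.1 hS).2
    · intro S hS
      exact erase_insert fun h => by simpa using mem_powerset.1 hS h
    · intro S hS
      congr 1
      ext i
      have := (mem_filter.1 hS).2
      simp only [mem_sdiff, mem_erase]
      constructor
      · rintro ⟨h1, h2⟩; exact ⟨⟨fun h => h2 (h ▸ this), h1⟩, fun h => h2 h.2⟩
      · rintro ⟨⟨h1, h2⟩, h3⟩; exact ⟨h2, fun h => h3 ⟨h1, h⟩⟩
  · intro S j
    simp only [mem_powerset, mem_filter]
    exact ⟨fun h => ⟨⟨h.1, h.2⟩, h.1 h.2⟩, fun h => ⟨h.1.1, h.1.2⟩⟩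

theorem sum_powerset_sum_sdiff {M : Type*} [AddCommMonoid M] (I : Finset ι)
    (G : ι → Finset ι → Finset ι → M) :
    ∑ S ∈ I.powerset, ∑ j ∈ I \ S, G j S ((I \ S).erase j) =
      ∑ j ∈ I, ∑ S ∈ (I.erase j).powerset, G j S ((I.erase j) \ S) := by
  rw [sum_comm' (t' := I) (s' := fun j => (I.erase j).powerset)]
  · refine sum_congr rfl fun j _ => sum_congr rfl fun S _ => ?_
    congr 1
    ext i
    simp only [mem_sdiff, mem_erase]
    tauto
  · intro S j
    simp only [mem_powerset, mem_sdiff, subset_erase]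
    tauto

theorem hurwitzPoly_eq_sub {y : ℚ} (hα : ∀ i, 0 ≤ α i) (hy : 0 < y) (T : Finset ι) :
    hurwitzPoly α y T = (y + ∑ i ∈ T, α i) ^ #T -
      ∑ j ∈ T, α j * (y + α j + ∑ i ∈ T.erase j, α i) ^ #(T.erase j) := by
  have h : ∀ j ∈ T, α j * (y + α j + ∑ i ∈ T.erase j, α i) ^ #(T.erase j) =
      α j * (y + ∑ i ∈ T, α i) ^ (#T - 1) := by
    intro j hj
    rw [card_erase_of_mem hj, add_assoc, add_sum_erase _ _ hj]
  rw [sum_congr rfl h, ← sum_mul, hurwitzPoly]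
  have h0 := (add_sum_pos hα hy T).ne'
  rcases T.eq_empty_or_nonempty with rfl | hT
  · simp [hy.ne']
  · obtain ⟨m, hm⟩ := Nat.exists_eq_succ_of_ne_zero (card_pos.2 hT).ne'
    rw [hm]
    simp only [Nat.succ_eq_add_one, Nat.cast_add, Nat.cast_one, add_sub_cancel_right, zpow_natCast,
      Nat.add_sub_cancel]
    ring

/-- Hurwitz's generalization of Abel's identity: the polynomials are of binomial type. -/
theorem sum_hurwitzPoly_mul_hurwitzPoly (hα : ∀ i, 0 ≤ α i) {x y : ℚ} (hx : 0 < x) (hy : 0 < y)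
    (I : Finset ι) :
    ∑ S ∈ I.powerset, hurwitzPoly α x S * hurwitzPoly α y (I \ S) = hurwitzPoly α (x + y) I := by
  simp only [hurwitzPoly_eq_sub hα hy, mul_sub, sum_sub_distrib, mul_sum]
  rw [sum_hurwitzPoly_mul_pow hα hx, hurwitzPoly_eq_sub hα (add_pos hx hy),
    sum_powerset_sum_sdiff I fun j S R =>
      hurwitzPoly α x S * (α j * (y + α j + ∑ i ∈ R, α i) ^ #R)]
  congr 1
  refine sum_congr rfl fun j _ => ?_
  rw [add_assoc x y, ← sum_hurwitzPoly_mul_pow hα hx, mul_sum]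
  exact sum_congr rfl fun S _ => by ring

theorem zpow_card_sub_two_eq (hα : ∀ i, 0 ≤ α i) {x : ℚ} (hx : 0 < x) (S : Finset ι) :
    (x + ∑ i ∈ S, α i) ^ ((#S : ℤ) - 2) = (x ^ 2)⁻¹ * hurwitzPoly α x S -
      ∑ j ∈ S, x⁻¹ * (α j / (x + α j)) * hurwitzPoly α (x + α j) (S.erase j) := by
  have h0 := (add_sum_pos hα hx S).ne'
  have h : ∀ j ∈ S, x⁻¹ * (α j / (x + α j)) * hurwitzPoly α (x + α j) (S.erase j) =
      α j * (x⁻¹ * (x + ∑ i ∈ S, α i) ^ ((#S : ℤ) - 2)) := by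
    intro j hj
    have h1 : x + α j ≠ 0 := (add_pos_of_pos_of_nonneg hx (hα j)).ne'
    have h2 : ((#S - 1 : ℕ) : ℤ) - 1 = #S - 2 := by
      have := card_pos.2 ⟨j, hj⟩
      omega
    rw [hurwitzPoly, card_erase_of_mem hj, add_assoc, add_sum_erase _ _ hj, h2]
    field_simp
  rw [sum_congr rfl h, ← sum_mul, hurwitzPoly,
    show (#S : ℤ) - 1 = (#S - 2) + 1 by ring, zpow_add_one₀ h0]
  field_simp
  ring

theorem sum_zpow_mul_zpow (hα : ∀ i, 0 ≤ α i) {x y : ℚ} (hx : 0 < x) (hy : 0 < y)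
    (I : Finset ι) :
    ∑ S ∈ I.powerset, (x + ∑ i ∈ S, α i) ^ ((#S : ℤ) - 2) *
        (y + ∑ i ∈ I \ S, α i) ^ ((#(I \ S) : ℤ) - 2) =
      (x ^ 2)⁻¹ * (y ^ 2)⁻¹ * hurwitzPoly α (x + y) I
      - ∑ j ∈ I, ((x ^ 2)⁻¹ * (y⁻¹ * (α j / (y + α j))) + (y ^ 2)⁻¹ * (x⁻¹ * (α j / (x + α j)))) *
          hurwitzPoly α (x + y + α j) (I.erase j)
      + ∑ j ∈ I, ∑ k ∈ I.erase j, (x⁻¹ * (α j / (x + α j))) * (y⁻¹ * (α k / (y + α k))) *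
          hurwitzPoly α (x + y + α j + α k) ((I.erase j).erase k) := by
  simp only [zpow_card_sub_two_eq hα hx, zpow_card_sub_two_eq hα hy]
  have e : ∀ a b c d : ℚ, (a - b) * (c - d) = a * c - a * d - b * c + b * d := by intros; ring
  simp only [e, sum_add_distrib, sum_sub_distrib]
  have h1 : ∑ S ∈ I.powerset, (x ^ 2)⁻¹ * hurwitzPoly α x S * ((y ^ 2)⁻¹ * hurwitzPoly α y (I \ S))
      = (x ^ 2)⁻¹ * (y ^ 2)⁻¹ * hurwitzPoly α (x + y) I := by
    rw [← sum_hurwitzPoly_mul_hurwitzPoly hα hx hy, mul_sum]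
    exact sum_congr rfl fun S _ => by ring
  have h2 : ∑ S ∈ I.powerset, (x ^ 2)⁻¹ * hurwitzPoly α x S *
      ∑ j ∈ I \ S, y⁻¹ * (α j / (y + α j)) * hurwitzPoly α (y + α j) ((I \ S).erase j) =
      ∑ j ∈ I, (x ^ 2)⁻¹ * (y⁻¹ * (α j / (y + α j))) *
        hurwitzPoly α (x + y + α j) (I.erase j) := by
    simp only [mul_sum]
    rw [sum_powerset_sum_sdiff I fun j S R => (x ^ 2)⁻¹ * hurwitzPoly α x S *
      (y⁻¹ * (α j / (y + α j)) * hurwitzPoly α (y + α j) R)]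
    refine sum_congr rfl fun j _ => ?_
    rw [add_assoc, ← sum_hurwitzPoly_mul_hurwitzPoly hα hx (add_pos_of_pos_of_nonneg hy (hα j)),
      mul_sum]
    exact sum_congr rfl fun S _ => by ring
  have h3 : ∑ S ∈ I.powerset,
      (∑ j ∈ S, x⁻¹ * (α j / (x + α j)) * hurwitzPoly α (x + α j) (S.erase j)) *
        ((y ^ 2)⁻¹ * hurwitzPoly α y (I \ S)) =
      ∑ j ∈ I, (y ^ 2)⁻¹ * (x⁻¹ * (α j / (x + α j))) *
        hurwitzPoly α (x + y + α j) (I.erase j) := by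
    simp only [sum_mul]
    rw [sum_powerset_sum_mem I fun j S R => x⁻¹ * (α j / (x + α j)) * hurwitzPoly α (x + α j) S *
      ((y ^ 2)⁻¹ * hurwitzPoly α y R)]
    refine sum_congr rfl fun j _ => ?_
    rw [add_right_comm, ← sum_hurwitzPoly_mul_hurwitzPoly hα (add_pos_of_pos_of_nonneg hx (hα j)) hy,
      mul_sum]
    exact sum_congr rfl fun S _ => by ring
  have h4 : ∑ S ∈ I.powerset,
      (∑ j ∈ S, x⁻¹ * (α j / (x + α j)) * hurwitzPoly α (x + α j) (S.erase j)) *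
        ∑ k ∈ I \ S, y⁻¹ * (α k / (y + α k)) * hurwitzPoly α (y + α k) ((I \ S).erase k) =
      ∑ j ∈ I, ∑ k ∈ I.erase j, (x⁻¹ * (α j / (x + α j))) * (y⁻¹ * (α k / (y + α k))) *
          hurwitzPoly α (x + y + α j + α k) ((I.erase j).erase k) := by
    simp only [sum_mul]
    rw [sum_powerset_sum_mem I fun j S R => x⁻¹ * (α j / (x + α j)) * hurwitzPoly α (x + α j) S *
      ∑ k ∈ R, y⁻¹ * (α k / (y + α k)) * hurwitzPoly α (y + α k) (R.erase k)]
    refine sum_congr rfl fun j _ => ?_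
    simp only [mul_sum]
    rw [sum_powerset_sum_sdiff (I.erase j) fun k S R =>
      x⁻¹ * (α j / (x + α j)) * hurwitzPoly α (x + α j) S *
        (y⁻¹ * (α k / (y + α k)) * hurwitzPoly α (y + α k) R)]
    refine sum_congr rfl fun k _ => ?_
    rw [show x + y + α j + α k = (x + α j) + (y + α k) by ring,
      ← sum_hurwitzPoly_mul_hurwitzPoly hα (add_pos_of_pos_of_nonneg hx (hα j))
        (add_pos_of_pos_of_nonneg hy (hα k)), mul_sum]
    exact sum_congr rfl fun S _ => by ring
  rw [h1, h2, h3, h4]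
  simp only [add_mul, sum_add_distrib]
  ring

end HurwitzPoly

/-- The numbers `n ^ n / n!`. -/
def powDivFactorial (n : ℕ) : ℚ := (n : ℚ) ^ n / n.factorial

theorem powDivFactorial_pos (n : ℕ) : 0 < powDivFactorial n := by
  rcases n.eq_zero_or_pos with rfl | hn
  · simp [powDivFactorial]
  · unfold powDivFactorial; positivity

theorem sum_range_neg_one_pow_mul_choose_mul_pow {n p : ℕ} (h : p < n) :
    ∑ k ∈ range (n + 1), (-1 : ℚ) ^ k * n.choose k * (k : ℚ) ^ p = 0 := by
  have := sum_powerset_neg_one_pow_mul_pow (fun _ : ℕ => (1 : ℚ)) (range n) p 0 (by simpa using h)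
  simp only [sum_const, nsmul_eq_mul, mul_one, zero_add] at this
  rw [sum_powerset_apply_card (fun m => (-1 : ℚ) ^ m * (m : ℚ) ^ p), card_range] at this
  rw [← this]
  exact sum_congr rfl fun k _ => by rw [nsmul_eq_mul]; ring

theorem sum_range_neg_one_pow_mul_choose_div (n : ℕ) : ∀ b : ℕ,
    ∑ k ∈ range (n + 1), (-1 : ℚ) ^ k * n.choose k / (k + (b + 1 : ℕ)) =
      n.factorial * b.factorial / (b + 1 + n).factorial := by
  induction n with
  | zero => intro b; simp [Nat.factorial_succ]; field_simp
  | succ n ih =>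
    intro b
    have h1 : ∑ k ∈ range (n + 2), (-1 : ℚ) ^ k * (n + 1).choose k / (k + (b + 1 : ℕ)) =
        ∑ k ∈ range (n + 1), (-1 : ℚ) ^ k * n.choose k / (k + (b + 1 : ℕ)) -
        ∑ k ∈ range (n + 1), (-1 : ℚ) ^ k * n.choose k / (k + (b + 1 + 1 : ℕ)) := by
      have h2 : ∑ k ∈ range (n + 1), (-1 : ℚ) ^ k * n.choose k / (k + (b + 1 : ℕ)) =
        ∑ k ∈ range (n + 2), (-1 : ℚ) ^ k * n.choose k / (k + (b + 1 : ℕ)) := by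
        rw [sum_range_succ _ (n + 1)]; simp
      rw [h2, sum_range_succ' _ (n + 1), sum_range_succ' _ (n + 1), add_sub_right_comm,
        ← sum_sub_distrib]
      congr 1
      · refine sum_congr rfl fun k _ => ?_
        rw [Nat.choose_succ_succ]
        push_cast
        have e : (k : ℚ) + 1 + (b + 1) = k + (b + 1 + 1) := by ring
        rw [e]; ring
      · simp
    rw [h1, ih b, ih (b + 1)]
    have e1 : b + 1 + (n + 1) = (b + 1 + n) + 1 := by ring
    have e2 : b + 1 + 1 + n = (b + 1 + n) + 1 := by ring
    rw [e1, e2, Nat.factorial_succ (b + 1 + n), Nat.factorial_succ b, Nat.factorial_succ n]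
    have : ((b + 1 + n).factorial : ℚ) ≠ 0 := by positivity
    push_cast
    field_simp
    ring

theorem sum_range_neg_one_pow_mul_choose_mul_pow_div (n b : ℕ) :
    ∑ k ∈ range (n + 1), (-1 : ℚ) ^ k * n.choose k * (k : ℚ) ^ n / (k + (b + 1 : ℕ)) =
      (-(b + 1 : ℕ) : ℚ) ^ n * (n.factorial * b.factorial / (b + 1 + n).factorial) := by
  rw [← sum_range_neg_one_pow_mul_choose_div, mul_sum]
  have h : ∀ k : ℕ, (-1 : ℚ) ^ k * n.choose k * (k : ℚ) ^ n / (k + (b + 1 : ℕ)) =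
      ∑ i ∈ range n, (-1 : ℚ) ^ k * n.choose k * (k : ℚ) ^ i * (-(b + 1 : ℕ) : ℚ) ^ (n - 1 - i) +
      (-(b + 1 : ℕ) : ℚ) ^ n * ((-1 : ℚ) ^ k * n.choose k / (k + (b + 1 : ℕ))) := by
    intro k
    have h0 : (k : ℚ) + (b + 1 : ℕ) ≠ 0 := by positivity
    have h1 := (Commute.all (k : ℚ) (-(b + 1 : ℕ) : ℚ)).geom_sum₂_mul n
    have h2 : ∑ i ∈ range n, (-1 : ℚ) ^ k * n.choose k * (k : ℚ) ^ i *
        (-(b + 1 : ℕ) : ℚ) ^ (n - 1 - i) = (-1 : ℚ) ^ k * n.choose k *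
        ∑ i ∈ range n, (k : ℚ) ^ i * (-(b + 1 : ℕ) : ℚ) ^ (n - 1 - i) := by
      rw [mul_sum]; exact sum_congr rfl fun i _ => by ring
    rw [h2, sub_neg_eq_add] at *
    field_simp
    linear_combination -(n.choose k : ℚ) * h1
  rw [sum_congr rfl fun k _ => h k, sum_add_distrib, sum_comm, add_eq_right]
  refine sum_eq_zero fun i hi => ?_
  rw [← sum_mul, sum_range_neg_one_pow_mul_choose_mul_pow (mem_range.1 hi), zero_mul]

theorem sum_range_powDivFactorial_mul (a : ℕ) (f : ℕ → ℚ) :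
    ∑ k ∈ range (a + 1), powDivFactorial k * powDivFactorial (a - k) * f k =
      ∑ n ∈ range (a + 1), (a : ℚ) ^ (a - n) / ((a - n).factorial * n.factorial) * (-1) ^ n *
        ∑ k ∈ range (n + 1), (-1 : ℚ) ^ k * n.choose k * (k : ℚ) ^ n * f k := by
  have h : ∀ k ∈ range (a + 1), powDivFactorial k * powDivFactorial (a - k) * f k =
      ∑ n ∈ Ico k (a + 1), (a : ℚ) ^ (a - n) / ((a - n).factorial * n.factorial) * (-1) ^ n *
        ((-1 : ℚ) ^ k * n.choose k * (k : ℚ) ^ n * f k) := by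
    intro k hk
    have hk' : k ≤ a := Nat.lt_succ_iff.1 (mem_range.1 hk)
    have e : ((a - k : ℕ) : ℚ) = -k + a := by rw [Nat.cast_sub hk']; ring
    rw [sum_Ico_eq_sum_range, show a + 1 - k = a - k + 1 by omega, powDivFactorial,
      powDivFactorial, e, add_pow, div_mul_div_comm, mul_sum, sum_div, sum_mul]
    refine sum_congr rfl fun i hi => ?_
    have hi' : i ≤ a - k := Nat.lt_succ_iff.1 (mem_range.1 hi)
    rw [Nat.cast_choose ℚ hi', Nat.cast_choose ℚ (Nat.le_add_right k i), Nat.add_sub_cancel_left,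
      Nat.sub_sub, neg_pow, pow_add, pow_add]
    have : ((-1 : ℚ) ^ k) ^ 2 = 1 := by rw [← pow_mul, mul_comm, pow_mul]; simp
    field_simp
    linear_combination -((k : ℚ) ^ i * f k) * this
  rw [sum_congr rfl h, sum_comm' (t' := range (a + 1)) (s' := fun n => range (n + 1))]
  · simp only [mul_sum]
  · intro k n
    simp only [mem_range, mem_Ico]
    omega

theorem sum_range_powDivFactorial_mul_div (a b : ℕ) :
    (b + 1 : ℕ) * powDivFactorial (b + 1) *
      ∑ k ∈ range (a + 1), powDivFactorial k * powDivFactorial (a - k) / (k + (b + 1 : ℕ)) =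
      ∑ n ∈ range (a + 1), (a : ℚ) ^ (a - n) * (b + 1 : ℕ) ^ (b + 1 + n) /
        ((a - n).factorial * (b + 1 + n).factorial) := by
  simp only [div_eq_mul_inv _ ((_ : ℚ) + (b + 1 : ℕ))]
  rw [sum_range_powDivFactorial_mul]
  simp only [← div_eq_mul_inv _ ((_ : ℚ) + (b + 1 : ℕ))]
  rw [mul_sum]
  refine sum_congr rfl fun n _ => ?_
  rw [sum_range_neg_one_pow_mul_choose_mul_pow_div, powDivFactorial, Nat.factorial_succ b, neg_pow,
    pow_add _ (b + 1) n]
  push_cast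
  field_simp
  rw [one_pow, mul_one, ← mul_pow]
  congr 1
  ring

theorem powDivFactorial_add (a b : ℕ) (ha : 1 ≤ a) (hb : 1 ≤ b) :
    b * powDivFactorial b *
        ∑ k ∈ range (a + 1), powDivFactorial k * powDivFactorial (a - k) / (k + b : ℚ) +
      a * powDivFactorial a *
        ∑ k ∈ range (b + 1), powDivFactorial k * powDivFactorial (b - k) / (k + a : ℚ) =
      powDivFactorial (a + b) + powDivFactorial a * powDivFactorial b := by
  obtain ⟨a, rfl⟩ := Nat.exists_eq_add_of_le' ha
  obtain ⟨b, rfl⟩ := Nat.exists_eq_add_of_le' hb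
  rw [sum_range_powDivFactorial_mul_div, sum_range_powDivFactorial_mul_div]
  generalize a + 1 = a at *
  generalize b + 1 = b at *
  set t : ℕ → ℚ := fun j => (a : ℚ) ^ j * b ^ (a + b - j) / (j.factorial * (a + b - j).factorial)
    with ht
  have h1 : ∑ n ∈ range (a + 1), (a : ℚ) ^ (a - n) * b ^ (b + n) /
      ((a - n).factorial * (b + n).factorial) = ∑ j ∈ range (a + 1), t j := by
    rw [← sum_range_reflect]
    refine sum_congr rfl fun j hj => ?_
    have := mem_range.1 hj
    rw [ht, show a + 1 - 1 - j = a - j by omega, show a - (a - j) = j by omega,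
      show b + (a - j) = a + b - j by omega]
  have h2 : ∑ n ∈ range (b + 1), (b : ℚ) ^ (b - n) * a ^ (a + n) /
      ((b - n).factorial * (a + n).factorial) = ∑ n ∈ range (b + 1), t (a + n) := by
    refine sum_congr rfl fun j hj => ?_
    have := mem_range.1 hj
    simp only [ht]
    rw [show a + b - (a + j) = b - j by omega]
    ring
  have h3 : powDivFactorial (a + b) = ∑ j ∈ range (a + b + 1), t j := by
    rw [powDivFactorial, Nat.cast_add, add_pow, sum_div]
    refine sum_congr rfl fun j hj => ?_
    rw [Nat.cast_choose ℚ (Nat.lt_succ_iff.1 (mem_range.1 hj))]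
    simp only [ht]
    field_simp
  have h4 : t a = powDivFactorial a * powDivFactorial b := by
    simp only [ht, powDivFactorial, Nat.add_sub_cancel_left]
    field_simp
  rw [h1, h2, h3, ← h4, show a + b + 1 = (a + 1) + b by ring, sum_range_add t (a + 1) b,
    sum_range_succ' _ b, add_zero, add_assoc]
  congr 2
  exact sum_congr rfl fun j _ => by congr 1; omega

theorem sum_range_powDivFactorial_mul_inv (a : ℕ) (ha : 1 ≤ a) :
    ∑ k ∈ range (a + 1), powDivFactorial k * powDivFactorial (a - k) * (k : ℚ)⁻¹ =
      powDivFactorial a := by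
  rw [sum_range_powDivFactorial_mul, sum_eq_single 1]
  · obtain ⟨a, rfl⟩ := Nat.exists_eq_add_of_le' ha
    rw [sum_range_succ, sum_range_succ, powDivFactorial, Nat.factorial_succ]
    simp
    field_simp
    push_cast [Nat.factorial_succ]
    ring
  · intro n _ hn
    rcases n with _ | n
    · simp
    · have : ∀ k ∈ range (n + 1 + 1), (-1 : ℚ) ^ k * (n + 1).choose k * (k : ℚ) ^ (n + 1) * (k : ℚ)⁻¹
          = (-1 : ℚ) ^ k * (n + 1).choose k * (k : ℚ) ^ n := by
        intro k _
        rcases k.eq_zero_or_pos with rfl | hk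
        · simp [show n ≠ 0 by omega]
        · field_simp
          ring
      rw [sum_congr rfl this, sum_range_neg_one_pow_mul_choose_mul_pow n.lt_succ_self, mul_zero]
  · intro h
    exact absurd (mem_range.2 (by omega)) h

/-- The truncated convolution `∑ A k * A (a - k) / (k + b)` over `0 < k < a`,
where `A n = n ^ n / n!`. -/
def innerConv (a : ℕ) (b : ℚ) : ℚ :=
  ∑ k ∈ Ico 1 a, powDivFactorial k * powDivFactorial (a - k) / (k + b)

theorem innerConv_zero {a : ℕ} (ha : 1 ≤ a) :
    innerConv a 0 = powDivFactorial a - powDivFactorial a / a := by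
  have h := sum_range_powDivFactorial_mul_inv a ha
  rw [sum_range_succ, range_eq_Ico, sum_eq_sum_Ico_succ_bot ha] at h
  simp only [powDivFactorial, innerConv, add_zero, div_eq_mul_inv _ (_ : ℚ)] at h ⊢
  simp at h
  linear_combination h

theorem innerConv_symm {a b : ℕ} (ha : 1 ≤ a) (hb : 1 ≤ b) :
    b * innerConv a b / powDivFactorial a + a * innerConv b a / powDivFactorial b =
      powDivFactorial (a + b) / (powDivFactorial a * powDivFactorial b) - 2 := by
  have key : ∀ a b : ℕ, 1 ≤ a →
      ∑ k ∈ range (a + 1), powDivFactorial k * powDivFactorial (a - k) / (k + b : ℚ) =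
        innerConv a b + powDivFactorial a / b + powDivFactorial a / (a + b) := by
    intro a b ha
    rw [sum_range_succ, range_eq_Ico, sum_eq_sum_Ico_succ_bot ha, innerConv]
    simp [powDivFactorial]
    ring
  have h := powDivFactorial_add a b ha hb
  rw [key a b ha, key b a hb] at h
  have hA := (powDivFactorial_pos a).ne'
  have hB := (powDivFactorial_pos b).ne'
  have ha' : (a : ℚ) ≠ 0 := by positivity
  have hb' : (b : ℚ) ≠ 0 := by positivity
  have hab : (a : ℚ) + b ≠ 0 := by positivity
  rw [add_comm (b : ℚ) a] at h
  field_simp at h ⊢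
  apply mul_left_cancel₀ hab
  linear_combination h

theorem sum_Ico_one_comm {a : ℕ} (f : ℕ → ℕ → ℚ) :
    ∑ k ∈ Ico 1 a, f k (a - k) = ∑ k ∈ Ico 1 a, f (a - k) k := by
  refine sum_nbij' (fun k => a - k) (fun k => a - k) ?_ ?_ ?_ ?_ ?_ <;>
    · intro k hk
      simp only [mem_Ico] at hk ⊢
      first | omega | (rw [show a - (a - k) = k by omega])

theorem innerConv_mul_div (a : ℕ) (b c : ℚ) (hb : 0 ≤ b) (hc : 0 ≤ c) :
    ∑ k ∈ Ico 1 a, powDivFactorial k * powDivFactorial (a - k) *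
      ((a + b + c) / ((k + b) * ((a - k : ℕ) + c))) = innerConv a b + innerConv a c := by
  have h : innerConv a c = ∑ k ∈ Ico 1 a, powDivFactorial k * powDivFactorial (a - k) /
      ((a - k : ℕ) + c) := by
    rw [sum_Ico_one_comm fun k l => powDivFactorial k * powDivFactorial l / (l + c), innerConv]
    exact sum_congr rfl fun k _ => by ring
  rw [h, innerConv, ← sum_add_distrib]
  refine sum_congr rfl fun k hk => ?_
  have hk := mem_Ico.1 hk
  have h1 : (0 : ℚ) < k := by exact_mod_cast hk.1
  have h2 : (0 : ℚ) < (a - k : ℕ) := by exact_mod_cast Nat.sub_pos_of_lt hk.2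
  have h3 : (a : ℚ) = k + (a - k : ℕ) := by rw [Nat.cast_sub hk.2.le]; ring
  rw [h3]
  generalize ((a - k : ℕ) : ℚ) = l at *
  have h4 : (k : ℚ) + b ≠ 0 := by positivity
  have h5 : l + c ≠ 0 := by positivity
  field_simp
  ring

section Cut

variable {ι : Type*} [DecidableEq ι] (α : ι → ℕ)

/-- The contribution to the cut-and-join recursion of the transpositions cutting a cycle of
length `a` in the presence of other cycles of lengths `α j`, `j ∈ J`. -/
def cutSum (a : ℕ) (J : Finset ι) : ℚ :=
  ∑ k ∈ Ico 1 a, ∑ S ∈ J.powerset,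
    (k * powDivFactorial k * (k + ∑ j ∈ S, (α j : ℚ)) ^ ((#S : ℤ) - 2)) *
    ((a - k : ℕ) * powDivFactorial (a - k) *
      ((a - k : ℕ) + ∑ j ∈ J \ S, (α j : ℚ)) ^ ((#(J \ S) : ℤ) - 2))

theorem cutSum_eq_aux {a : ℕ} (J : Finset ι) {D : ℚ} (hD : a + ∑ j ∈ J, (α j : ℚ) = D) :
    cutSum α a J = 2 * innerConv a 0 * D ^ ((#J : ℤ) - 1)
      - 2 * ∑ j ∈ J, α j * (innerConv a 0 + innerConv a (α j)) * D ^ ((#J : ℤ) - 2)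
      + ∑ j ∈ J, ∑ k ∈ J.erase j, α j * α k * (innerConv a (α j) + innerConv a (α k)) *
          D ^ ((#J : ℤ) - 3) := by
  have h1 : ∀ k ∈ Ico 1 a, ∑ S ∈ J.powerset,
      (k * powDivFactorial k * (k + ∑ j ∈ S, (α j : ℚ)) ^ ((#S : ℤ) - 2)) *
      ((a - k : ℕ) * powDivFactorial (a - k) *
        ((a - k : ℕ) + ∑ j ∈ J \ S, (α j : ℚ)) ^ ((#(J \ S) : ℤ) - 2)) =
      powDivFactorial k * powDivFactorial (a - k) * ((a + 0 + 0) / ((k + 0) * ((a - k : ℕ) + 0))) *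
        D ^ ((#J : ℤ) - 1)
      - ∑ j ∈ J, α j * (powDivFactorial k * powDivFactorial (a - k) *
          ((a + 0 + α j) / ((k + 0) * ((a - k : ℕ) + α j))) +
          powDivFactorial k * powDivFactorial (a - k) *
          ((a + α j + 0) / ((k + α j) * ((a - k : ℕ) + 0)))) * D ^ ((#J : ℤ) - 2)
      + ∑ j ∈ J, ∑ i ∈ J.erase j, α j * α i * (powDivFactorial k * powDivFactorial (a - k) *
          ((a + α j + α i) / ((k + α j) * ((a - k : ℕ) + α i)))) * D ^ ((#J : ℤ) - 3) := by
    intro k hk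
    have hk := mem_Ico.1 hk
    have hk1 : (0 : ℚ) < k := by exact_mod_cast hk.1
    have hl : (0 : ℚ) < (a - k : ℕ) := by exact_mod_cast Nat.sub_pos_of_lt hk.2
    have ha : (a : ℚ) = k + (a - k : ℕ) := by rw [Nat.cast_sub hk.2.le]; ring
    have h2 := sum_zpow_mul_zpow (α := fun j => (α j : ℚ)) (fun j => Nat.cast_nonneg _) hk1 hl J
    have h3 : ∑ S ∈ J.powerset,
      (k * powDivFactorial k * (k + ∑ j ∈ S, (α j : ℚ)) ^ ((#S : ℤ) - 2)) *
      ((a - k : ℕ) * powDivFactorial (a - k) *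
        ((a - k : ℕ) + ∑ j ∈ J \ S, (α j : ℚ)) ^ ((#(J \ S) : ℤ) - 2)) =
        (k * powDivFactorial k * ((a - k : ℕ) * powDivFactorial (a - k))) * 
        ∑ S ∈ J.powerset, (k + ∑ j ∈ S, (α j : ℚ)) ^ ((#S : ℤ) - 2) *
          ((a - k : ℕ) + ∑ j ∈ J \ S, (α j : ℚ)) ^ ((#(J \ S) : ℤ) - 2) := by
      rw [mul_sum]; exact sum_congr rfl fun S _ => by ring
    rw [h3, h2, ← ha]
    have e1 : hurwitzPoly (fun j => (α j : ℚ)) a J = a * D ^ ((#J : ℤ) - 1) := by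
      rw [hurwitzPoly, hD]
    have e2 : ∀ j ∈ J, hurwitzPoly (fun j => (α j : ℚ)) (a + α j) (J.erase j) =
        (a + α j) * D ^ ((#J : ℤ) - 2) := by
      intro j hj
      have := card_pos.2 ⟨j, hj⟩
      rw [hurwitzPoly, add_assoc (a : ℚ) (α j), add_sum_erase J (fun j => (α j : ℚ)) hj, hD,
        card_erase_of_mem hj]
      congr 2
      omega
    have e3 : ∀ j ∈ J, ∀ i ∈ J.erase j,
        hurwitzPoly (fun j => (α j : ℚ)) (a + α j + α i) ((J.erase j).erase i) =
        (a + α j + α i) * D ^ ((#J : ℤ) - 3) := by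
      intro j hj i hi
      have h4 := card_pos.2 ⟨i, hi⟩
      have h5 := card_erase_of_mem hj
      rw [hurwitzPoly, add_assoc (a + α j : ℚ) (α i),
        add_sum_erase (J.erase j) (fun j => (α j : ℚ)) hi,
        add_assoc (a : ℚ) (α j) (∑ i ∈ J.erase j, (α i : ℚ)), add_sum_erase J (fun j => (α j : ℚ)) hj, hD,
        card_erase_of_mem hi]
      congr 2
      omega
    rw [mul_add, mul_sub, e1, mul_sum, mul_sum]
    simp only [mul_sum]
    generalize ((a - k : ℕ) : ℚ) = l at *
    congr 1
    · congr 1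
      · field_simp
        ring
      · refine sum_congr rfl fun j hj => ?_
        rw [e2 j hj]
        have h4 : (k : ℚ) + α j ≠ 0 := by positivity
        have h5 : l + α j ≠ 0 := by positivity
        field_simp
        ring
    · refine sum_congr rfl fun j hj => sum_congr rfl fun i hi => ?_
      rw [e3 j hj i hi]
      have h4 : (k : ℚ) + α j ≠ 0 := by positivity
      have h5 : l + α i ≠ 0 := by positivity
      field_simp
  rw [cutSum, sum_congr rfl h1, sum_add_distrib, sum_sub_distrib, ← sum_mul,
    innerConv_mul_div _ _ _ le_rfl le_rfl, sum_comm (t := J), sum_comm (t := J)]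
  congr 1
  · congr 1
    · ring
    · rw [mul_sum]
      refine sum_congr rfl fun j _ => ?_
      rw [← sum_mul, ← mul_sum, sum_add_distrib, innerConv_mul_div _ _ _ le_rfl (Nat.cast_nonneg _),
        innerConv_mul_div _ _ _ (Nat.cast_nonneg _) le_rfl]
      ring
  · refine sum_congr rfl fun j _ => ?_
    rw [sum_comm]
    refine sum_congr rfl fun i _ => ?_
    rw [← sum_mul, ← mul_sum, innerConv_mul_div _ _ _ (Nat.cast_nonneg _) (Nat.cast_nonneg _)]

theorem sum_erase_comm {M : Type*} [AddCommMonoid M] (I : Finset ι) (f : ι → ι → M) :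
    ∑ i ∈ I, ∑ j ∈ I.erase i, f i j = ∑ i ∈ I, ∑ j ∈ I.erase i, f j i := by
  refine sum_comm' fun i j => ?_
  simp only [mem_erase]
  tauto

theorem cutSum_eq {a : ℕ} (ha : 1 ≤ a) (J : Finset ι) {D : ℚ} (hD : a + ∑ j ∈ J, (α j : ℚ) = D) :
    cutSum α a J / powDivFactorial a = 2 * (a - 1) * D ^ ((#J : ℤ) - 2)
      - 2 * ∑ j ∈ J, (a + α j) * (α j * innerConv a (α j) / powDivFactorial a) *
          D ^ ((#J : ℤ) - 3) := by
  have ha' : (0 : ℚ) < a := by exact_mod_cast ha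
  have hD0 : D ≠ 0 := by
    rw [← hD]; exact (add_pos_of_pos_of_nonneg ha' (by positivity)).ne'
  have hA := (powDivFactorial_pos a).ne'
  have h1 : ∑ j ∈ J, ∑ k ∈ J.erase j, α j * α k * (innerConv a (α j) + innerConv a (α k)) *
      D ^ ((#J : ℤ) - 3) = 2 * ∑ j ∈ J, (D - a - α j) * (α j * innerConv a (α j)) *
      D ^ ((#J : ℤ) - 3) := by
    simp only [mul_add, add_mul, sum_add_distrib]
    rw [sum_erase_comm J fun j k => (α j : ℚ) * α k * innerConv a (α k) * D ^ ((#J : ℤ) - 3),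
      ← sum_add_distrib, mul_sum]
    refine sum_congr rfl fun j hj => ?_
    have h2 : ∑ k ∈ J.erase j, (α k : ℚ) = D - a - α j := by
      rw [← hD, ← add_sum_erase _ _ hj]; ring
    rw [← h2, ← sum_add_distrib, sum_mul, sum_mul, mul_sum]
    exact sum_congr rfl fun k _ => by ring
  have h3 : ∑ j ∈ J, (α j : ℚ) = D - a := by rw [← hD]; ring
  rw [cutSum_eq_aux α J hD, h1, innerConv_zero ha]
  have h4 : D ^ ((#J : ℤ) - 2) = D ^ ((#J : ℤ) - 3) * D := by
    rw [← zpow_add_one₀ hD0]; congr 1; ring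
  have h5 : D ^ ((#J : ℤ) - 1) = D ^ ((#J : ℤ) - 3) * D * D := by
    rw [← zpow_add_one₀ hD0, ← zpow_add_one₀ hD0]; congr 1; ring
  rw [h4, h5]
  generalize D ^ ((#J : ℤ) - 3) = E
  generalize powDivFactorial a = A at *
  have h6 : ∑ j ∈ J, (α j : ℚ) * (A - A / a + innerConv a (α j)) * (E * D) =
      (A - A / a) * (E * D) * (D - a) + E * D * ∑ j ∈ J, α j * innerConv a (α j) := by
    rw [← h3, mul_sum, mul_sum, ← sum_add_distrib]
    exact sum_congr rfl fun j _ => by ring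
  have h7 : ∑ j ∈ J, (D - a - α j) * (α j * innerConv a (α j)) * E =
      E * D * ∑ j ∈ J, α j * innerConv a (α j) -
        ∑ j ∈ J, (a + α j) * (α j * innerConv a (α j)) * E := by
    rw [mul_sum, ← sum_sub_distrib]
    exact sum_congr rfl fun j _ => by ring
  have h8 : ∑ j ∈ J, (a + α j) * (α j * innerConv a (α j) / A) * E =
      (∑ j ∈ J, (a + α j) * (α j * innerConv a (α j)) * E) / A := by
    rw [sum_div]
    exact sum_congr rfl fun j _ => by ring
  rw [h6, h7, h8]
  field_simp
  ring

/-- The polynomial identity expressing that Hurwitz's formula solves the cut-and-join recursion,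
normalized by the product of the weights of the parts. -/
theorem cut_and_join_normalized (I : Finset ι) (hI : I.Nonempty) (hα : ∀ i ∈ I, 1 ≤ α i) {D : ℚ}
    (hD : ∑ i ∈ I, (α i : ℚ) = D) :
    ∑ i ∈ I, ∑ j ∈ I.erase i, (α i + α j : ℚ) *
        (powDivFactorial (α i + α j) / (powDivFactorial (α i) * powDivFactorial (α j))) *
        D ^ ((#I : ℤ) - 4) +
      ∑ i ∈ I, cutSum α (α i) (I.erase i) / powDivFactorial (α i) =
      2 * (D + #I - 2) * D ^ ((#I : ℤ) - 3) := by
  have hD0 : D ≠ 0 := by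
    rw [← hD]
    exact (sum_pos (fun i hi => by exact_mod_cast hα i hi) hI).ne'
  set T : ι → ι → ℚ := fun i j => α j * innerConv (α i) (α j) / powDivFactorial (α i) with hT
  have h1 : ∀ i ∈ I, cutSum α (α i) (I.erase i) / powDivFactorial (α i) =
      2 * (α i - 1) * D ^ ((#I : ℤ) - 3) -
        2 * ∑ j ∈ I.erase i, (α i + α j) * T i j * D ^ ((#I : ℤ) - 4) := by
    intro i hi
    have := card_pos.2 hI
    rw [cutSum_eq α (hα i hi) (I.erase i) (by rw [add_sum_erase I (fun i => (α i : ℚ)) hi, hD]),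
      card_erase_of_mem hi, show ((#I - 1 : ℕ) : ℤ) - 2 = #I - 3 by omega,
      show ((#I - 1 : ℕ) : ℤ) - 3 = #I - 4 by omega]
  have h2 : 2 * ∑ i ∈ I, ∑ j ∈ I.erase i, (α i + α j) * T i j * D ^ ((#I : ℤ) - 4) =
      ∑ i ∈ I, ∑ j ∈ I.erase i, (α i + α j : ℚ) *
        (powDivFactorial (α i + α j) / (powDivFactorial (α i) * powDivFactorial (α j))) *
        D ^ ((#I : ℤ) - 4) -
      2 * ∑ i ∈ I, ∑ j ∈ I.erase i, (α i + α j : ℚ) * D ^ ((#I : ℤ) - 4) := by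
    rw [two_mul]
    conv_lhs => rhs; rw [sum_erase_comm]
    simp only [mul_sum, ← sum_add_distrib, ← sum_sub_distrib]
    refine sum_congr rfl fun i hi => sum_congr rfl fun j hj => ?_
    have h3 := innerConv_symm (hα i hi) (hα j (mem_of_mem_erase hj))
    simp only [hT]
    linear_combination (α i + α j : ℚ) * D ^ ((#I : ℤ) - 4) * h3
  have h4 : ∑ i ∈ I, ∑ j ∈ I.erase i, (α i + α j : ℚ) * D ^ ((#I : ℤ) - 4) =
      2 * (#I - 1) * D ^ ((#I : ℤ) - 3) := by
    simp only [add_mul, sum_add_distrib]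
    conv_lhs => rhs; rw [sum_erase_comm]
    have : ∀ i ∈ I, ∑ j ∈ I.erase i, (α i : ℚ) * D ^ ((#I : ℤ) - 4) =
        α i * ((#I - 1) * D ^ ((#I : ℤ) - 4)) := by
      intro i hi
      rw [sum_const, card_erase_of_mem hi, nsmul_eq_mul, Nat.cast_pred (card_pos.2 hI)]
      ring
    rw [sum_congr rfl this, ← sum_mul, hD, show (#I : ℤ) - 3 = #I - 4 + 1 by ring,
      zpow_add_one₀ hD0]
    ring
  have h5 : ∑ i ∈ I, 2 * ((α i : ℚ) - 1) * D ^ ((#I : ℤ) - 3) =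
      2 * (D - #I) * D ^ ((#I : ℤ) - 3) := by
    rw [← sum_mul, ← mul_sum, sum_sub_distrib, hD]
    simp
  rw [sum_congr rfl h1, sum_sub_distrib, ← mul_sum, h2, h4, h5]
  ring

end Cut

/-- The weight `n ^ (n + 1) / n!` of a cycle of length `n` in Hurwitz's formula. -/
def cycleWeight (n : ℕ) : ℚ := n * powDivFactorial n

/-- The polynomial form of the cut-and-join recursion satisfied by Hurwitz's formula. -/
theorem cut_and_join {ι : Type*} [DecidableEq ι] (α : ι → ℕ) (I : Finset ι) (hI : I.Nonempty)
    (hα : ∀ i ∈ I, 1 ≤ α i) {D : ℚ} (hD : ∑ i ∈ I, (α i : ℚ) = D) :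
    ∑ i ∈ I, ∑ j ∈ I.erase i, (α i : ℚ) * α j * (D ^ ((#I : ℤ) - 4) *
        (cycleWeight (α i + α j) * ∏ l ∈ (I.erase i).erase j, cycleWeight (α l))) +
      ∑ i ∈ I, (α i : ℚ) * ∑ k ∈ Ico 1 (α i), ∑ S ∈ (I.erase i).powerset,
        ((k + ∑ j ∈ S, (α j : ℚ)) ^ ((#S : ℤ) - 2) *
          (cycleWeight k * ∏ j ∈ S, cycleWeight (α j))) *
        (((α i - k : ℕ) + ∑ j ∈ I.erase i \ S, (α j : ℚ)) ^ ((#(I.erase i \ S) : ℤ) - 2) *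
          (cycleWeight (α i - k) * ∏ j ∈ I.erase i \ S, cycleWeight (α j))) =
      2 * (D + #I - 2) * (D ^ ((#I : ℤ) - 3) * ∏ i ∈ I, cycleWeight (α i)) := by
  rw [← mul_assoc, ← cut_and_join_normalized α I hI hα hD, add_mul, sum_mul, sum_mul]
  congr 1
  · refine sum_congr rfl fun i hi => ?_
    rw [sum_mul]
    refine sum_congr rfl fun j hj => ?_
    rw [← mul_prod_erase I _ hi, ← mul_prod_erase _ _ hj]
    have h1 := (powDivFactorial_pos (α i)).ne'
    have h2 := (powDivFactorial_pos (α j)).ne'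
    simp only [cycleWeight]
    push_cast
    field_simp
  · refine sum_congr rfl fun i hi => ?_
    rw [← mul_prod_erase I _ hi, cutSum, mul_sum, sum_div, sum_mul]
    refine sum_congr rfl fun k _ => ?_
    rw [mul_sum, sum_div, sum_mul]
    refine sum_congr rfl fun S hS => ?_
    rw [← prod_sdiff (mem_powerset.1 hS)]
    have h1 : cycleWeight (α i) / powDivFactorial (α i) = α i :=
      mul_div_cancel_right₀ _ (powDivFactorial_pos (α i)).ne'
    rw [div_mul_eq_mul_div, mul_div_assoc, mul_div_right_comm (cycleWeight (α i)), h1,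
      cycleWeight, cycleWeight]
    ring

namespace Equiv.Perm

variable {X : Type*} [Fintype X] [DecidableEq X] (σ : Perm X) {a b x y : X} {V : Finset X}

/-- The cycle of `σ` through `x`, as a finset; it is `{x}` if `x` is a fixed point. -/
def cycleSet (x : X) : Finset X := univ.filter (σ.SameCycle x)

/-- The cycles of `σ` meeting `V`, fixed points included. -/
def cycleSets (V : Finset X) : Finset (Finset X) := V.image σ.cycleSet

/-- `V` is a union of cycles of `σ`. -/
def IsInvariant (V : Finset X) : Prop := ∀ x ∈ V, ∀ y, σ.SameCycle x y → y ∈ V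

variable {σ}

theorem mem_cycleSet : y ∈ σ.cycleSet x ↔ σ.SameCycle x y := by simp [cycleSet]

theorem self_mem_cycleSet : x ∈ σ.cycleSet x := mem_cycleSet.2 (SameCycle.refl σ x)

theorem cycleSet_eq_iff : σ.cycleSet x = σ.cycleSet y ↔ σ.SameCycle x y := by
  refine ⟨fun h => mem_cycleSet.1 (h ▸ self_mem_cycleSet), fun h => ?_⟩
  ext z
  simp only [mem_cycleSet]
  exact ⟨h.symm.trans, h.trans⟩

theorem cycleSet_eq_of_mem (h : y ∈ σ.cycleSet x) : σ.cycleSet y = σ.cycleSet x :=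
  cycleSet_eq_iff.2 (mem_cycleSet.1 h).symm

theorem mem_cycleSets {C : Finset X} : C ∈ σ.cycleSets V ↔ ∃ x ∈ V, σ.cycleSet x = C :=
  mem_image

theorem cycleSet_mem_cycleSets (h : x ∈ V) : σ.cycleSet x ∈ σ.cycleSets V :=
  mem_image_of_mem _ h

theorem cycleSet_eq_of_mem_cycleSets {C : Finset X} (hC : C ∈ σ.cycleSets V) (hx : x ∈ C) :
    σ.cycleSet x = C := by
  obtain ⟨y, -, rfl⟩ := mem_cycleSets.1 hC
  exact cycleSet_eq_of_mem hx

omit [DecidableEq X] in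
theorem IsInvariant.of_apply_mem (h : ∀ x ∈ V, σ x ∈ V) : σ.IsInvariant V := by
  intro x hx y hxy
  obtain ⟨i, rfl⟩ := hxy.exists_nat_pow_eq
  induction i with
  | zero => exact hx
  | succ i ih =>
    rw [pow_succ', mul_apply]
    exact h _ (ih (sameCycle_pow_right.2 (SameCycle.refl σ x)))

omit [Fintype X] [DecidableEq X] in
theorem IsInvariant.apply_mem (h : σ.IsInvariant V) (hx : x ∈ V) : σ x ∈ V :=
  h x hx _ (sameCycle_apply_right.2 (SameCycle.refl σ x))

theorem IsInvariant.cycleSet_subset (h : σ.IsInvariant V) (hx : x ∈ V) : σ.cycleSet x ⊆ V :=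
  fun y hy => h x hx y (mem_cycleSet.1 hy)

theorem IsInvariant.biUnion {S : Finset (Finset X)} (hS : S ⊆ σ.cycleSets V) :
    σ.IsInvariant (S.biUnion id) := by
  intro x hx y hxy
  obtain ⟨C, hC, hxC⟩ := mem_biUnion.1 hx
  refine mem_biUnion.2 ⟨C, hC, ?_⟩
  rw [id, ← cycleSet_eq_of_mem_cycleSets (hS hC) hxC]
  exact mem_cycleSet.2 hxy

theorem cycleSets_biUnion {S : Finset (Finset X)} (hS : S ⊆ σ.cycleSets V) :
    σ.cycleSets (S.biUnion id) = S := by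
  ext C
  simp only [mem_cycleSets, mem_biUnion, id]
  constructor
  · rintro ⟨x, ⟨B, hB, hx⟩, rfl⟩
    rwa [cycleSet_eq_of_mem_cycleSets (hS hB) hx]
  · intro hC
    obtain ⟨x, -, rfl⟩ := mem_cycleSets.1 (hS hC)
    exact ⟨x, ⟨_, hC, self_mem_cycleSet⟩, rfl⟩

theorem IsInvariant.biUnion_cycleSets (h : σ.IsInvariant V) : (σ.cycleSets V).biUnion id = V := by
  ext x
  simp only [mem_biUnion, id]
  constructor
  · rintro ⟨C, hC, hx⟩
    obtain ⟨y, hy, rfl⟩ := mem_cycleSets.1 hC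
    exact h.cycleSet_subset hy hx
  · exact fun hx => ⟨_, cycleSet_mem_cycleSets hx, self_mem_cycleSet⟩

theorem pairwiseDisjoint_cycleSets :
    ((σ.cycleSets V : Finset (Finset X)) : Set (Finset X)).PairwiseDisjoint id := by
  intro C hC B hB hne
  rw [Function.onFun, disjoint_left]
  intro x hx hx'
  exact hne ((cycleSet_eq_of_mem_cycleSets hC hx).symm.trans (cycleSet_eq_of_mem_cycleSets hB hx'))

theorem IsInvariant.sum_eq {M : Type*} [AddCommMonoid M] (h : σ.IsInvariant V) (f : X → M) :
    ∑ x ∈ V, f x = ∑ C ∈ σ.cycleSets V, ∑ x ∈ C, f x := by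
  conv_lhs => rw [← h.biUnion_cycleSets]
  exact sum_biUnion pairwiseDisjoint_cycleSets

theorem IsInvariant.sum_card (h : σ.IsInvariant V) : ∑ C ∈ σ.cycleSets V, (#C : ℚ) = #V := by
  have := h.sum_eq (fun _ => (1 : ℚ))
  simpa using this.symm

theorem card_pos_of_mem_cycleSets {C : Finset X} (hC : C ∈ σ.cycleSets V) : 1 ≤ #C := by
  obtain ⟨x, -, rfl⟩ := mem_cycleSets.1 hC
  exact card_pos.2 ⟨x, self_mem_cycleSet⟩

theorem isCycleOn_cycleSet : σ.IsCycleOn (σ.cycleSet x : Set X) := by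
  refine ⟨⟨fun y hy => ?_, σ.injective.injOn, fun y hy => ⟨σ.symm y, ?_, σ.apply_symm_apply y⟩⟩, ?_⟩
  · simp only [mem_coe, mem_cycleSet, sameCycle_apply_right] at hy ⊢
    exact hy
  · rw [mem_coe, mem_cycleSet, ← sameCycle_apply_right, Equiv.apply_symm_apply]
    exact mem_cycleSet.1 hy
  · intro y hy z hz
    simp only [mem_coe, mem_cycleSet] at hy hz
    exact hy.symm.trans hz

theorem cycleSet_eq_image_of_pow_apply_eq {n : ℕ} (hn : 0 < n) (h : (σ ^ n) x = x) :
    σ.cycleSet x = (range n).image fun i => (σ ^ i) x := by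
  ext y
  simp only [mem_cycleSet, mem_image, mem_range]
  constructor
  · intro hxy
    obtain ⟨i, rfl⟩ := hxy.exists_nat_pow_eq
    refine ⟨i % n, Nat.mod_lt _ hn, ?_⟩
    conv_rhs => rw [← Nat.mod_add_div i n]
    rw [pow_add, mul_apply, pow_mul, pow_apply_eq_self_of_apply_eq_self h]
  · rintro ⟨i, -, rfl⟩
    exact sameCycle_pow_right.2 (SameCycle.refl σ x)

theorem cycleSet_eq_image : σ.cycleSet x = (range #(σ.cycleSet x)).image fun i => (σ ^ i) x :=
  cycleSet_eq_image_of_pow_apply_eq (card_pos.2 ⟨x, self_mem_cycleSet⟩)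
    (isCycleOn_cycleSet.pow_card_apply self_mem_cycleSet)

theorem pow_apply_inj {i j : ℕ} (hi : i < #(σ.cycleSet x)) (hj : j < #(σ.cycleSet x))
    (h : (σ ^ i) x = (σ ^ j) x) : i = j :=
  ((isCycleOn_cycleSet.pow_apply_eq_pow_apply self_mem_cycleSet).1 h).eq_of_lt_of_lt hi hj

theorem sum_cycleSet_erase {M : Type*} [AddCommMonoid M] (f : X → M) :
    ∑ y ∈ (σ.cycleSet x).erase x, f y = ∑ k ∈ Ico 1 #(σ.cycleSet x), f ((σ ^ k) x) := by
  have h : (σ.cycleSet x).erase x = (Ico 1 #(σ.cycleSet x)).image fun i => (σ ^ i) x := by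
    conv_lhs => rw [cycleSet_eq_image]
    have hx := card_pos.2 ⟨x, self_mem_cycleSet (σ := σ)⟩
    rw [range_eq_Ico, ← insert_Ico_succ_left_eq_Ico hx, image_insert, pow_zero, one_apply,
      erase_insert]
    · rfl
    · simp only [mem_image, mem_Ico, not_exists, not_and]
      intro i hi h
      have := pow_apply_inj (j := 0) hi.2 hx h
      simp [this] at hi
  rw [h, sum_image]
  exact fun i hi j hj => pow_apply_inj (mem_Ico.1 hi).2 (mem_Ico.1 hj).2

omit [Fintype X] in
theorem swap_mul_pow_apply {i : ℕ} (h : ∀ j, 0 < j → j ≤ i → (σ ^ j) x ≠ a ∧ (σ ^ j) x ≠ b) :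
    ((swap a b * σ) ^ i) x = (σ ^ i) x := by
  induction i with
  | zero => rfl
  | succ i ih =>
    rw [pow_succ', mul_apply, ih fun j hj hji => h j hj (by omega), mul_apply, ← mul_apply σ,
      ← pow_succ']
    exact swap_apply_of_ne_of_ne (h _ (by omega) le_rfl).1 (h _ (by omega) le_rfl).2

theorem cycleSet_swap_mul_of_not_sameCycle (ha : ¬σ.SameCycle x a) (hb : ¬σ.SameCycle x b) :
    (swap a b * σ).cycleSet x = σ.cycleSet x := by
  have h : ∀ i, ((swap a b * σ) ^ i) x = (σ ^ i) x := fun i => swap_mul_pow_apply fun j _ _ =>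
    ⟨fun e => ha (e ▸ sameCycle_pow_right.2 (SameCycle.refl σ x)),
      fun e => hb (e ▸ sameCycle_pow_right.2 (SameCycle.refl σ x))⟩
  ext y
  simp only [mem_cycleSet]
  constructor <;> intro hy <;> obtain ⟨i, rfl⟩ := hy.exists_nat_pow_eq
  · rw [h]
    exact sameCycle_pow_right.2 (SameCycle.refl σ x)
  · rw [← h]
    exact sameCycle_pow_right.2 (SameCycle.refl _ x)

omit [Fintype X] in
theorem swap_mul_swap_mul : swap a b * (swap a b * σ) = σ := by
  rw [← mul_assoc, swap_mul_self, one_mul]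

theorem sameCycle_swap_mul (h : ¬σ.SameCycle a b) : (swap a b * σ).SameCycle a b := by
  have h1 := card_pos.2 ⟨a, self_mem_cycleSet (σ := σ)⟩
  obtain ⟨m, hm⟩ := Nat.exists_eq_succ_of_ne_zero h1.ne'
  have h2 : (σ ^ (m + 1)) a = a := by
    have := isCycleOn_cycleSet.pow_card_apply (self_mem_cycleSet (σ := σ) (x := a))
    rwa [hm] at this
  have h3 : ((swap a b * σ) ^ m) a = (σ ^ m) a := by
    refine swap_mul_pow_apply fun j hj hjm => ⟨fun e => ?_, fun e => ?_⟩
    · have := pow_apply_inj (j := 0) (by omega) (by omega) e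
      omega
    · exact h (e ▸ sameCycle_pow_right.2 (SameCycle.refl σ a))
  refine ⟨(m + 1 : ℕ), ?_⟩
  rw [zpow_natCast, pow_succ', mul_apply, h3, mul_apply, ← mul_apply σ, ← pow_succ', h2,
    swap_apply_left]

theorem cycleSet_swap_mul_pow {k : ℕ} (hk : k ∈ Ico 1 #(σ.cycleSet a)) :
    (swap a ((σ ^ k) a) * σ).cycleSet a = (range k).image fun i => (σ ^ i) a := by
  have hk := mem_Ico.1 hk
  have h1 : ∀ i < k, ((swap a ((σ ^ k) a) * σ) ^ i) a = (σ ^ i) a := by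
    refine fun i hi => swap_mul_pow_apply fun j hj hji => ⟨fun e => ?_, fun e => ?_⟩
    · have := pow_apply_inj (j := 0) (by omega) (by omega) e
      omega
    · have := pow_apply_inj (by omega) (by omega) e
      omega
  rw [cycleSet_eq_image_of_pow_apply_eq hk.1]
  · exact image_congr fun i hi => h1 i (by simpa using hi)
  · obtain ⟨m, rfl⟩ := Nat.exists_eq_succ_of_ne_zero (Nat.pos_iff_ne_zero.1 hk.1)
    rw [Nat.succ_eq_add_one, pow_succ', mul_apply, h1 m m.lt_succ_self, mul_apply, ← mul_apply σ,
      ← pow_succ', swap_apply_right]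

theorem card_cycleSet_swap_mul_pow {k : ℕ} (hk : k ∈ Ico 1 #(σ.cycleSet a)) :
    #((swap a ((σ ^ k) a) * σ).cycleSet a) = k := by
  have hk' := mem_Ico.1 hk
  rw [cycleSet_swap_mul_pow hk, card_image_of_injOn, card_range]
  intro i hi j hj h
  have hi := mem_range.1 (mem_coe.1 hi)
  have hj := mem_range.1 (mem_coe.1 hj)
  exact pow_apply_inj (by omega) (by omega) h

theorem not_sameCycle_swap_mul_pow {k : ℕ} (hk : k ∈ Ico 1 #(σ.cycleSet a)) :
    ¬(swap a ((σ ^ k) a) * σ).SameCycle a ((σ ^ k) a) := by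
  have hk' := mem_Ico.1 hk
  rw [← mem_cycleSet, cycleSet_swap_mul_pow hk, mem_image]
  rintro ⟨i, hi, h⟩
  have hi := mem_range.1 hi
  have := pow_apply_inj (by omega) (by omega) h
  omega

theorem SameCycle.exists_mem_Ico (h : σ.SameCycle a b) (hab : a ≠ b) :
    ∃ k ∈ Ico 1 #(σ.cycleSet a), b = (σ ^ k) a := by
  have := mem_cycleSet.2 h
  rw [cycleSet_eq_image, mem_image] at this
  obtain ⟨k, hk, rfl⟩ := this
  refine ⟨k, mem_Ico.2 ⟨Nat.one_le_iff_ne_zero.2 ?_, mem_range.1 hk⟩, Eq.refl _⟩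
  rintro rfl
  exact hab (Eq.refl _)

theorem SameCycle.not_sameCycle_swap_mul (h : σ.SameCycle a b) (hab : a ≠ b) :
    ¬(swap a b * σ).SameCycle a b := by
  obtain ⟨k, hk, rfl⟩ := h.exists_mem_Ico hab
  exact not_sameCycle_swap_mul_pow hk

theorem cycleSet_swap_mul_subset (h : σ.SameCycle a b) :
    (swap a b * σ).cycleSet a ⊆ σ.cycleSet a := by
  intro x hx
  by_contra hx'
  rw [mem_cycleSet] at hx hx'
  have := cycleSet_swap_mul_of_not_sameCycle (σ := σ) (a := a) (b := b) (x := x)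
    (fun e => hx' e.symm) (fun e => hx' (h.trans e.symm))
  exact hx' (mem_cycleSet.1 (this ▸ mem_cycleSet.2 hx.symm)).symm

theorem cycleSet_swap_mul_union (h : σ.SameCycle a b) :
    (swap a b * σ).cycleSet a ∪ (swap a b * σ).cycleSet b = σ.cycleSet a := by
  refine Subset.antisymm (union_subset (cycleSet_swap_mul_subset h) ?_) fun x hx => ?_
  · rw [swap_comm, cycleSet_eq_iff.2 h]
    exact cycleSet_swap_mul_subset h.symm
  · by_contra hx'
    rw [mem_union, mem_cycleSet, mem_cycleSet] at hx'
    push Not at hx'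
    have := cycleSet_swap_mul_of_not_sameCycle (σ := swap a b * σ) (a := a) (b := b) (x := x)
      (fun e => hx'.1 e.symm) (fun e => hx'.2 e.symm)
    rw [swap_mul_swap_mul] at this
    exact hx'.1 (mem_cycleSet.1 (this ▸ mem_cycleSet.2 (mem_cycleSet.1 hx).symm)).symm

theorem disjoint_cycleSet (h : ¬σ.SameCycle a b) :
    _root_.Disjoint (σ.cycleSet a) (σ.cycleSet b) := by
  rw [disjoint_left]
  intro x hx hx'
  exact h ((mem_cycleSet.1 hx).trans (mem_cycleSet.1 hx').symm)

theorem card_cycleSet_swap_mul_pow' {k : ℕ} (hk : k ∈ Ico 1 #(σ.cycleSet a)) :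
    #((swap a ((σ ^ k) a) * σ).cycleSet ((σ ^ k) a)) = #(σ.cycleSet a) - k := by
  rw [← cycleSet_swap_mul_union (sameCycle_pow_right.2 (SameCycle.refl σ a) :
    σ.SameCycle a ((σ ^ k) a)), card_union_of_disjoint
    (disjoint_cycleSet (not_sameCycle_swap_mul_pow hk)), card_cycleSet_swap_mul_pow hk,
    Nat.add_sub_cancel_left]

theorem IsInvariant.swap_mul (h : σ.IsInvariant V) (ha : a ∈ V) (hb : b ∈ V) :
    (swap a b * σ).IsInvariant V := by
  refine IsInvariant.of_apply_mem fun x hx => ?_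
  rw [mul_apply, swap_apply_def]
  split_ifs
  exacts [hb, ha, h.apply_mem hx]

theorem IsInvariant.cycleSet_swap_mul (h : σ.IsInvariant V) (ha : a ∉ V) (hb : b ∉ V)
    (hx : x ∈ V) : (swap a b * σ).cycleSet x = σ.cycleSet x :=
  cycleSet_swap_mul_of_not_sameCycle (fun e => ha (h x hx a e)) (fun e => hb (h x hx b e))

theorem IsInvariant.swap_mul_of_notMem (h : σ.IsInvariant V) (ha : a ∉ V) (hb : b ∉ V) :
    (swap a b * σ).IsInvariant V := by
  intro x hx y hxy
  refine h x hx y (mem_cycleSet.1 ?_)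
  rw [← h.cycleSet_swap_mul ha hb hx]
  exact mem_cycleSet.2 hxy

theorem IsInvariant.cycleSets_swap_mul (h : σ.IsInvariant V) (ha : a ∉ V) (hb : b ∉ V) :
    (swap a b * σ).cycleSets V = σ.cycleSets V :=
  image_congr fun _ hx => h.cycleSet_swap_mul ha hb hx

theorem erase_cycleSets_swap_mul (h : σ.SameCycle a b) :
    (((swap a b * σ).cycleSets V).erase ((swap a b * σ).cycleSet a)).erase
      ((swap a b * σ).cycleSet b) = (σ.cycleSets V).erase (σ.cycleSet a) := by
  have key : ∀ x, σ.cycleSet x ≠ σ.cycleSet a → (swap a b * σ).cycleSet x = σ.cycleSet x := by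
    intro x hx
    rw [Ne, cycleSet_eq_iff] at hx
    exact cycleSet_swap_mul_of_not_sameCycle hx fun e => hx (e.trans h.symm)
  ext C
  simp only [mem_erase, mem_cycleSets]
  constructor
  · rintro ⟨h1, h2, x, hx, rfl⟩
    have h3 : σ.cycleSet x ≠ σ.cycleSet a := by
      intro e
      have h4 : x ∈ σ.cycleSet a := e ▸ self_mem_cycleSet
      rw [← cycleSet_swap_mul_union h, mem_union] at h4
      exact h4.elim (fun h4 => h2 (cycleSet_eq_of_mem h4)) fun h4 => h1 (cycleSet_eq_of_mem h4)
    rw [key x h3]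
    exact ⟨h3, x, hx, rfl⟩
  · rintro ⟨h1, x, hx, rfl⟩
    refine ⟨fun e => h1 ?_, fun e => h1 ?_, x, hx, key x h1⟩
    · rw [cycleSet_eq_iff.2 h]
      have : b ∈ σ.cycleSet x := e ▸ self_mem_cycleSet
      exact (cycleSet_eq_of_mem this).symm
    · have : a ∈ σ.cycleSet x := e ▸ self_mem_cycleSet
      exact (cycleSet_eq_of_mem this).symm

end Equiv.Perm

namespace Equiv.Perm

variable {X : Type*} [DecidableEq X]

/-- The value predicted by Hurwitz's formula for a permutation with the given family of cycles,
up to the factorial factor. -/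
def familyWeight (I : Finset (Finset X)) : ℚ :=
  (∑ C ∈ I, (#C : ℚ)) ^ ((#I : ℤ) - 3) * ∏ C ∈ I, cycleWeight #C

theorem familyWeight_insert {C : Finset X} {S : Finset (Finset X)} (h : C ∉ S) :
    familyWeight (insert C S) =
      (#C + ∑ B ∈ S, (#B : ℚ)) ^ ((#S : ℤ) - 2) * (cycleWeight #C * ∏ B ∈ S, cycleWeight #B) := by
  rw [familyWeight, sum_insert h, prod_insert h, card_insert_of_notMem h]
  congr 2
  push_cast
  ring

variable [Fintype X]

open Classical in
/-- The value predicted by Hurwitz's formula for the restriction of `σ` to `V`, up to the factorial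
factor, extended by zero to subsets which are not invariant. -/
noncomputable def blockWeight (σ : Perm X) (V : Finset X) : ℚ :=
  if σ.IsInvariant V then familyWeight (σ.cycleSets V) else 0

variable {σ : Perm X} {a b : X} {V : Finset X}

theorem IsInvariant.blockWeight_eq (h : σ.IsInvariant V) :
    blockWeight σ V = familyWeight (σ.cycleSets V) := if_pos h

theorem blockWeight_eq_zero (h : ¬σ.IsInvariant V) : blockWeight σ V = 0 := if_neg h

theorem blockWeight_biUnion {S : Finset (Finset X)} (hS : S ⊆ σ.cycleSets V) :
    blockWeight σ (S.biUnion id) = familyWeight S := by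
  rw [(IsInvariant.biUnion hS).blockWeight_eq, cycleSets_biUnion hS]

/-- The subsets of `V` containing `a` but not `b`. -/
def separating (V : Finset X) (a b : X) : Finset (Finset X) :=
  V.powerset.filter fun A => a ∈ A ∧ b ∉ A

omit [Fintype X] in
theorem mem_separating {A : Finset X} : A ∈ separating V a b ↔ A ⊆ V ∧ a ∈ A ∧ b ∉ A := by
  simp [separating]

theorem sum_blockWeight_mul_blockWeight (hV : σ.IsInvariant V) (ha : a ∈ V) (hb : b ∈ V)
    (hab : ¬σ.SameCycle a b) {R : Finset (Finset X)}
    (hR : ((σ.cycleSets V).erase (σ.cycleSet a)).erase (σ.cycleSet b) = R) :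
    ∑ A ∈ separating V a b, blockWeight σ A * blockWeight σ (V \ A) =
      ∑ S ∈ R.powerset, familyWeight (insert (σ.cycleSet a) S) *
        familyWeight (insert (σ.cycleSet b) (R \ S)) := by
  have hRI : R ⊆ σ.cycleSets V := hR ▸ (erase_subset _ _).trans (erase_subset _ _)
  have haI : σ.cycleSet a ∈ σ.cycleSets V := cycleSet_mem_cycleSets ha
  have hbI : σ.cycleSet b ∈ σ.cycleSets V := cycleSet_mem_cycleSets hb
  have hne : σ.cycleSet a ≠ σ.cycleSet b := fun e => hab (cycleSet_eq_iff.1 e)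
  have haR : σ.cycleSet a ∉ R := by simp [← hR]
  have hbR : σ.cycleSet b ∉ R := by simp [← hR]
  have hI : insert (σ.cycleSet a) (insert (σ.cycleSet b) R) = σ.cycleSets V := by
    rw [← hR, insert_erase (mem_erase.2 ⟨hne.symm, hbI⟩), insert_erase haI]
  have hsub : ∀ S ∈ R.powerset, insert (σ.cycleSet a) S ⊆ σ.cycleSets V := fun S hS =>
    insert_subset haI ((mem_powerset.1 hS).trans hRI)
  have hsub' : ∀ S, insert (σ.cycleSet b) (R \ S) ⊆ σ.cycleSets V := fun S =>
    insert_subset hbI (sdiff_subset.trans hRI)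
  have hmem : ∀ S ∈ R.powerset, b ∉ (insert (σ.cycleSet a) S).biUnion id := by
    intro S hS hb'
    obtain ⟨C, hC, hbC⟩ := mem_biUnion.1 hb'
    rw [← cycleSet_eq_of_mem_cycleSets (hsub S hS hC) hbC, mem_insert] at hC
    exact hC.elim (fun e => hne e.symm) fun e => hbR (mem_powerset.1 hS e)
  have hcompl : ∀ S ∈ R.powerset, V \ (insert (σ.cycleSet a) S).biUnion id =
      (insert (σ.cycleSet b) (R \ S)).biUnion id := by
    intro S hS
    ext x
    rw [mem_sdiff]
    constructor
    · rintro ⟨hx, hx'⟩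
      have hxI := cycleSet_mem_cycleSets (σ := σ) hx
      refine mem_biUnion.2 ⟨σ.cycleSet x, ?_, self_mem_cycleSet⟩
      have hxS : σ.cycleSet x ∉ insert (σ.cycleSet a) S :=
        fun h => hx' (mem_biUnion.2 ⟨_, h, self_mem_cycleSet⟩)
      rw [← hI] at hxI
      simp only [mem_insert, mem_sdiff, not_or] at hxI hxS ⊢
      tauto
    · intro hx
      obtain ⟨C, hC, hxC⟩ := mem_biUnion.1 hx
      have hCI := hsub' S hC
      refine ⟨hV.biUnion_cycleSets ▸ mem_biUnion.2 ⟨C, hCI, hxC⟩, fun hx' => ?_⟩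
      obtain ⟨B, hB, hxB⟩ := mem_biUnion.1 hx'
      have : C = B := (cycleSet_eq_of_mem_cycleSets hCI hxC).symm.trans
        (cycleSet_eq_of_mem_cycleSets (hsub S hS hB) hxB)
      subst this
      rw [mem_insert, mem_sdiff] at hC
      rw [mem_insert] at hB
      rcases hC with rfl | hC
      · exact hB.elim (fun e => hne e.symm) fun e => hbR (mem_powerset.1 hS e)
      · exact hB.elim (fun e => haR (e ▸ hC.1)) hC.2
  classical
  rw [← sum_filter_of_ne (p := σ.IsInvariant)
    fun A _ h => by_contra fun h' => h (by rw [blockWeight_eq_zero h', zero_mul])]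
  refine (sum_nbij' (fun S => (insert (σ.cycleSet a) S).biUnion id)
    (fun A => (σ.cycleSets A).erase (σ.cycleSet a)) ?_ ?_ ?_ ?_ ?_).symm
  · intro S hS
    refine mem_filter.2 ⟨mem_separating.2 ⟨?_, ?_, hmem S hS⟩, IsInvariant.biUnion (hsub S hS)⟩
    · conv_rhs => rw [← hV.biUnion_cycleSets]
      exact biUnion_subset_biUnion_of_subset_left _ (hsub S hS)
    · exact mem_biUnion.2 ⟨_, mem_insert_self _ _, self_mem_cycleSet⟩
  · intro A hA
    obtain ⟨hA, hinv⟩ := mem_filter.1 hA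
    obtain ⟨hAV, -, hbA⟩ := mem_separating.1 hA
    rw [mem_powerset, ← hR]
    intro C hC
    obtain ⟨hCa, hC⟩ := mem_erase.1 hC
    obtain ⟨x, hx, rfl⟩ := mem_cycleSets.1 hC
    exact mem_erase.2 ⟨fun e => hbA (hinv x hx b (cycleSet_eq_iff.1 e)),
      mem_erase.2 ⟨hCa, cycleSet_mem_cycleSets (hAV hx)⟩⟩
  · intro S hS
    rw [cycleSets_biUnion (hsub S hS), erase_insert fun h => haR (mem_powerset.1 hS h)]
  · intro A hA
    obtain ⟨hA, hinv⟩ := mem_filter.1 hA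
    obtain ⟨-, haA, -⟩ := mem_separating.1 hA
    rw [insert_erase (cycleSet_mem_cycleSets haA), hinv.biUnion_cycleSets]
  · intro S hS
    rw [hcompl S hS, blockWeight_biUnion (hsub S hS), blockWeight_biUnion (hsub' S)]

/-- The cut-and-join recursion for the values predicted by Hurwitz's formula. -/
theorem sum_blockWeight_swap_mul (hV : σ.IsInvariant V) (hne : V.Nonempty) :
    ∑ a ∈ V, ∑ b ∈ V.erase a, (if σ.SameCycle a b then
        ∑ A ∈ separating V a b, blockWeight (swap a b * σ) A * blockWeight (swap a b * σ) (V \ A)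
      else blockWeight (swap a b * σ) V) =
      2 * (#V + #(σ.cycleSets V) - 2) * blockWeight σ V := by
  set I := σ.cycleSets V with hI
  have hInv := hV.blockWeight_eq
  rw [familyWeight, hV.sum_card] at hInv
  rw [hInv, ← cut_and_join (fun C : Finset X => #C) I (hne.image _)
    (fun C hC => card_pos_of_mem_cycleSets hC) hV.sum_card, hV.sum_eq, ← sum_add_distrib]
  refine sum_congr rfl fun C hC => ?_
  have hCV : ∀ B ∈ I, B ⊆ V := fun B hB => by
    obtain ⟨x, hx, rfl⟩ := mem_cycleSets.1 hB
    exact hV.cycleSet_subset hx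
  have key : ∀ a ∈ C, ∑ b ∈ V.erase a, (if σ.SameCycle a b then
        ∑ A ∈ separating V a b, blockWeight (swap a b * σ) A * blockWeight (swap a b * σ) (V \ A)
      else blockWeight (swap a b * σ) V) =
      ∑ B ∈ I.erase C, (#B : ℚ) * ((#V : ℚ) ^ ((#I : ℤ) - 4) *
        (cycleWeight (#C + #B) * ∏ l ∈ (I.erase C).erase B, cycleWeight #l)) +
      ∑ k ∈ Ico 1 #C, ∑ S ∈ (I.erase C).powerset,
        ((k + ∑ j ∈ S, (#j : ℚ)) ^ ((#S : ℤ) - 2) *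
          (cycleWeight k * ∏ j ∈ S, cycleWeight #j)) *
        (((#C - k : ℕ) + ∑ j ∈ I.erase C \ S, (#j : ℚ)) ^ ((#(I.erase C \ S) : ℤ) - 2) *
          (cycleWeight (#C - k) * ∏ j ∈ I.erase C \ S, cycleWeight #j)) := by
    intro a haC
    have ha : a ∈ V := hCV C hC haC
    have hCa : σ.cycleSet a = C := cycleSet_eq_of_mem_cycleSets hC haC
    set F : X → ℚ := fun b => if σ.SameCycle a b then
        ∑ A ∈ separating V a b, blockWeight (swap a b * σ) A * blockWeight (swap a b * σ) (V \ A)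
      else blockWeight (swap a b * σ) V with hF
    have h1 : ∑ b ∈ V.erase a, F b = ∑ B ∈ I.erase C, ∑ b ∈ B, F b + ∑ b ∈ C.erase a, F b := by
      have h2 := hV.sum_eq F
      rw [← hI, ← add_sum_erase I _ hC, ← add_sum_erase V _ ha, ← add_sum_erase C _ haC,
        add_assoc] at h2
      rw [add_left_cancel h2, add_comm]
    rw [h1]
    congr 1
    · refine sum_congr rfl fun B hB => ?_
      rw [← nsmul_eq_mul, ← sum_const]
      refine sum_congr rfl fun b hbB => ?_
      obtain ⟨hBC, hBI⟩ := mem_erase.1 hB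
      have hb : b ∈ V := hCV B hBI hbB
      have hBb : σ.cycleSet b = B := cycleSet_eq_of_mem_cycleSets hBI hbB
      have hab : ¬σ.SameCycle a b := fun h => hBC (by rw [← hBb, ← hCa, cycleSet_eq_iff.2 h])
      have hab' := sameCycle_swap_mul hab
      have h2 := cycleSet_swap_mul_union hab'
      have h3 := erase_cycleSets_swap_mul (V := V) hab'
      rw [swap_mul_swap_mul, hCa, hBb] at h2 h3
      rw [← hI] at h3
      have hinv := hV.swap_mul ha hb
      have h4 : #((swap a b * σ).cycleSets V) = #I - 1 := by
        have e1 := card_erase_of_mem (cycleSet_mem_cycleSets (σ := swap a b * σ) ha)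
        have e2 := card_pos.2 ⟨_, cycleSet_mem_cycleSets (σ := swap a b * σ) ha⟩
        have e3 := card_erase_of_mem hB
        have e4 := card_erase_of_mem hC
        have e5 := card_pos.2 ⟨B, hB⟩
        rw [← h3] at e1
        omega
      have h5 := card_pos.2 ⟨C, hC⟩
      simp only [hF]
      rw [if_neg hab, hinv.blockWeight_eq, familyWeight, hinv.sum_card, h4,
        ← mul_prod_erase _ _ (cycleSet_mem_cycleSets (σ := swap a b * σ) ha), ← h3, ← h2,
        card_union_of_disjoint (by rw [← hCa, ← hBb]; exact disjoint_cycleSet hab)]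
      congr 2
      omega
    · subst hCa
      rw [sum_cycleSet_erase]
      refine sum_congr rfl fun k hk => ?_
      have hab : σ.SameCycle a ((σ ^ k) a) := sameCycle_pow_right.2 (SameCycle.refl σ a)
      have hb := hV a ha _ hab
      have h2 := erase_cycleSets_swap_mul (V := V) hab
      have h3 := card_cycleSet_swap_mul_pow hk
      have h4 := card_cycleSet_swap_mul_pow' hk
      simp only [hF]
      rw [if_pos hab, sum_blockWeight_mul_blockWeight (hV.swap_mul ha hb) ha hb
        (not_sameCycle_swap_mul_pow hk) h2]
      refine sum_congr rfl fun S hS => ?_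
      rw [familyWeight_insert, familyWeight_insert, h3, h4]
      · intro h
        rw [← h2] at h
        simp at h
      · intro h
        have := mem_powerset.1 hS h
        rw [← h2] at this
        simp at this
  rw [sum_congr rfl key, sum_const, nsmul_eq_mul, mul_add, mul_sum]
  simp only [mul_assoc]

end Equiv.Perm

section BlockPartition

variable {X : Type*}

/-- `Q` is the set of blocks of a partition of `X`. -/
structure IsBlockPartition (Q : Finset (Finset X)) : Prop where
  cover : ∀ x, ∃ V ∈ Q, x ∈ V
  eq_of_mem : ∀ U ∈ Q, ∀ V ∈ Q, ∀ x ∈ U, x ∈ V → U = V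
  nonempty : ∀ V ∈ Q, V.Nonempty

/-- The members of `Q` are equivalence classes of `R`. -/
def IsClasses (R : X → X → Prop) (Q : Finset (Finset X)) : Prop :=
  ∀ V ∈ Q, ∀ x ∈ V, ∀ y, R x y ↔ y ∈ V

/-- The relation obtained from an equivalence relation by merging the classes of `a` and `b`. -/
def mergeRel (R : X → X → Prop) (a b x y : X) : Prop :=
  R x y ∨ (R x a ∧ R b y) ∨ (R x b ∧ R a y)

theorem equivalence_mergeRel {R : X → X → Prop} (hR : Equivalence R) (a b : X) :
    Equivalence (mergeRel R a b) := by
  have h1 := @hR.symm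
  have h2 := @hR.trans
  refine ⟨fun x => Or.inl (hR.refl x), ?_, ?_⟩
  · rintro x y (h | h | h)
    · exact Or.inl (h1 h)
    · exact Or.inr (Or.inr ⟨h1 h.2, h1 h.1⟩)
    · exact Or.inr (Or.inl ⟨h1 h.2, h1 h.1⟩)
  · rintro x y z (h | h | h) (k | k | k)
    · exact Or.inl (h2 h k)
    · exact Or.inr (Or.inl ⟨h2 h k.1, k.2⟩)
    · exact Or.inr (Or.inr ⟨h2 h k.1, k.2⟩)
    · exact Or.inr (Or.inl ⟨h.1, h2 h.2 k⟩)
    · exact Or.inr (Or.inl ⟨h.1, k.2⟩)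
    · exact Or.inl (h2 h.1 k.2)
    · exact Or.inr (Or.inr ⟨h.1, h2 h.2 k⟩)
    · exact Or.inl (h2 h.1 k.2)
    · exact Or.inr (Or.inr ⟨h.1, k.2⟩)

variable [DecidableEq X]

/-- The family of blocks obtained by cutting the block `V` into `A` and `V \ A`. -/
def splitBlock (Q : Finset (Finset X)) (V A : Finset X) : Finset (Finset X) :=
  insert A (insert (V \ A) (Q.erase V))

open Equiv.Perm

variable {Q : Finset (Finset X)} {V A : Finset X} {a b : X}

theorem isBlockPartition_splitBlock (hQ : IsBlockPartition Q) (hV : V ∈ Q)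
    (hA : A ∈ separating V a b) (hb : b ∈ V) : IsBlockPartition (splitBlock Q V A) := by
  obtain ⟨hAV, haA, hbA⟩ := mem_separating.1 hA
  have key : ∀ U ∈ Q.erase V, ∀ x ∈ U, x ∉ V := fun U hU x hx hxV =>
    (mem_erase.1 hU).1 (hQ.eq_of_mem U (mem_of_mem_erase hU) V hV x hx hxV)
  refine ⟨fun x => ?_, ?_, ?_⟩
  · obtain ⟨U, hU, hx⟩ := hQ.cover x
    by_cases hUV : U = V
    · subst hUV
      by_cases hxA : x ∈ A
      · exact ⟨A, by simp [splitBlock], hxA⟩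
      · exact ⟨U \ A, by simp [splitBlock], mem_sdiff.2 ⟨hx, hxA⟩⟩
    · exact ⟨U, by simp [splitBlock, hU, hUV], hx⟩
  · intro U hU W hW x hxU hxW
    simp only [splitBlock, mem_insert] at hU hW
    rcases hU with rfl | rfl | hU <;> rcases hW with rfl | rfl | hW
    · rfl
    · exact absurd hxU (mem_sdiff.1 hxW).2
    · exact absurd (hAV hxU) (key W hW x hxW)
    · exact absurd hxW (mem_sdiff.1 hxU).2
    · rfl
    · exact absurd (mem_sdiff.1 hxU).1 (key W hW x hxW)
    · exact absurd (hAV hxW) (key U hU x hxU)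
    · exact absurd (mem_sdiff.1 hxW).1 (key U hU x hxU)
    · exact hQ.eq_of_mem U (mem_of_mem_erase hU) W (mem_of_mem_erase hW) x hxU hxW
  · intro U hU
    simp only [splitBlock, mem_insert] at hU
    rcases hU with rfl | rfl | hU
    · exact ⟨a, haA⟩
    · exact ⟨b, mem_sdiff.2 ⟨hb, hbA⟩⟩
    · exact hQ.nonempty U (mem_of_mem_erase hU)

theorem isClasses_mergeRel_iff {R : X → X → Prop} (hR : Equivalence R) (hQ : IsBlockPartition Q)
    (hV : V ∈ Q) (ha : a ∈ V) (hb : b ∈ V) :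
    IsClasses (mergeRel R a b) Q ↔
      IsClasses R Q ∨ ∃ A ∈ separating V a b, IsClasses R (splitBlock Q V A) := by
  have hs := @hR.symm
  have ht := @hR.trans
  constructor
  · intro h
    by_cases hab : R a b
    · left
      intro U hU x hx y
      rw [← h U hU x hx y]
      exact ⟨Or.inl, fun h => h.elim id fun h =>
        h.elim (fun h => ht h.1 (ht hab h.2)) fun h => ht h.1 (ht (hs hab) h.2)⟩
    · right
      classical
      have hA : ∀ y, y ∈ V.filter (R a) ↔ R a y := fun y =>
        ⟨fun hy => (mem_filter.1 hy).2, fun hy => mem_filter.2 ⟨(h V hV a ha y).1 (Or.inl hy), hy⟩⟩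
      refine ⟨V.filter (R a), mem_separating.2 ⟨filter_subset _ _, (hA a).2 (hR.refl a),
        fun hb => hab ((hA b).1 hb)⟩, ?_⟩
      have hVx : ∀ x ∈ V, ¬R a x → R b x := by
        intro x hx hax
        rcases (h V hV a ha x).2 hx with h | h | h
        · exact absurd h hax
        · exact h.2
        · exact absurd h.1 hab
      intro U hU x hx y
      simp only [splitBlock, mem_insert] at hU
      rcases hU with rfl | rfl | hU
      · rw [hA] at hx ⊢
        exact ⟨ht hx, ht (hs hx)⟩
      · rw [mem_sdiff, hA] at hx ⊢
        refine ⟨fun hxy => ⟨(h V hV x hx.1 y).1 (Or.inl hxy), fun hay => hx.2 (ht hay (hs hxy))⟩,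
          fun hy => ht (hs (hVx x hx.1 hx.2)) (hVx y hy.1 hy.2)⟩
      · obtain ⟨hUV, hU⟩ := mem_erase.1 hU
        have hxV : x ∉ V := fun hxV => hUV (hQ.eq_of_mem U hU V hV x hx hxV)
        have hxa : ∀ c ∈ V, ¬R x c := fun c hc hxc =>
          hUV (hQ.eq_of_mem U hU V hV c ((h U hU x hx c).1 (Or.inl hxc)) hc)
        rw [← h U hU x hx y]
        exact ⟨Or.inl, fun h => h.elim id fun h =>
          h.elim (fun h => absurd h.1 (hxa a ha)) fun h => absurd h.1 (hxa b hb)⟩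
  · rintro (h | ⟨A, hA, h⟩) U hU x hx y
    · rw [← h U hU x hx y]
      have hab : R a b := (h V hV a ha b).2 hb
      exact ⟨fun h => h.elim id fun h =>
        h.elim (fun h => ht h.1 (ht hab h.2)) fun h => ht h.1 (ht (hs hab) h.2), Or.inl⟩
    · obtain ⟨hAV, haA, hbA⟩ := mem_separating.1 hA
      have h1 : ∀ x ∈ A, ∀ y, R x y ↔ y ∈ A := h A (by simp [splitBlock])
      have h2 : ∀ x ∈ V \ A, ∀ y, R x y ↔ y ∈ V \ A := h (V \ A) (by simp [splitBlock])
      have h3 := h1 a haA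
      have h4 := h2 b (mem_sdiff.2 ⟨hb, hbA⟩)
      by_cases hUV : U = V
      · subst hUV
        by_cases hxA : x ∈ A
        · have h5 : R x a := (h1 x hxA a).2 haA
          have h6 : ¬R x b := fun e => hbA ((h1 x hxA b).1 e)
          rw [mergeRel, h1 x hxA, h4, mem_sdiff]
          have := @hAV y
          tauto
        · have hx' := mem_sdiff.2 ⟨hx, hxA⟩
          have h5 : R x b := (h2 x hx' b).2 (mem_sdiff.2 ⟨hb, hbA⟩)
          have h6 : ¬R x a := fun e => (mem_sdiff.1 ((h2 x hx' a).1 e)).2 haA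
          rw [mergeRel, h2 x hx', h3, mem_sdiff]
          have := @hAV y
          tauto
      · have h5 := h U (by simp [splitBlock, hU, hUV]) x hx
        have h6 : ∀ c ∈ V, ¬R x c := fun c hc hxc =>
          hUV (hQ.eq_of_mem U hU V hV c ((h5 c).1 hxc) hc)
        have h7 := h6 a ha
        have h8 := h6 b hb
        rw [mergeRel, h5 y]
        tauto

omit [DecidableEq X] in
theorem not_isClasses_mergeRel {R : X → X → Prop} (hR : Equivalence R)
    (hV : V ∈ Q) (ha : a ∈ V) (hb : b ∉ V) : ¬IsClasses (mergeRel R a b) Q := fun h =>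
  hb ((h V hV a ha b).1 (Or.inr (Or.inl ⟨hR.refl a, hR.refl b⟩)))

omit [DecidableEq X] in
theorem IsClasses.eq_of_mem {R : X → X → Prop} {P : Finset (Finset X)} {U : Finset X} {x : X}
    (hQ : IsClasses R Q) (hP : IsClasses R P) (hU : U ∈ Q) (hV : V ∈ P) (hxU : x ∈ U)
    (hxV : x ∈ V) : U = V := by
  ext y
  rw [← hQ U hU x hxU, hP V hV x hxV]

end BlockPartition

section Factorization

open Equiv Equiv.Perm

variable {X : Type*} [DecidableEq X]

/-- Two points are related if some element of the group generated by the entries of `t` maps one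
to the other. -/
def orbitRelation {r : ℕ} (t : Fin r → Perm X) (x y : X) : Prop :=
  ∃ g ∈ Subgroup.closure (Set.range t), g x = y

omit [DecidableEq X] in
theorem equivalence_orbitRelation {r : ℕ} (t : Fin r → Perm X) : Equivalence (orbitRelation t) := by
  refine ⟨fun x => ⟨1, one_mem _, rfl⟩, ?_, ?_⟩
  · rintro x _ ⟨g, hg, rfl⟩
    exact ⟨g⁻¹, inv_mem hg, g.symm_apply_apply x⟩
  · rintro x _ _ ⟨g, hg, rfl⟩ ⟨h, hh, rfl⟩
    exact ⟨h * g, mul_mem hh hg, rfl⟩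

theorem orbitRelation_cons {r : ℕ} (t : Fin r → Perm X) (a b : X) :
    orbitRelation (Fin.cons (swap a b) t : Fin (r + 1) → Perm X) =
      mergeRel (orbitRelation t) a b := by
  have hE := equivalence_mergeRel (equivalence_orbitRelation t) a b
  have hT := equivalence_orbitRelation (Fin.cons (swap a b) t : Fin (r + 1) → Perm X)
  have hle : ∀ x y, orbitRelation t x y →
      orbitRelation (Fin.cons (swap a b) t : Fin (r + 1) → Perm X) x y := by
    rintro x y ⟨g, hg, h⟩
    exact ⟨g, Subgroup.closure_mono (by rw [Fin.range_cons]; exact Set.subset_insert _ _) hg, h⟩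
  have hab : orbitRelation (Fin.cons (swap a b) t : Fin (r + 1) → Perm X) a b :=
    ⟨swap a b, Subgroup.subset_closure ⟨0, rfl⟩, swap_apply_left a b⟩
  ext x y
  constructor
  · rintro ⟨g, hg, rfl⟩
    induction hg using Subgroup.closure_induction generalizing x with
    | mem g hg =>
      rw [Fin.range_cons, Set.mem_insert_iff] at hg
      have hR := equivalence_orbitRelation t
      rcases hg with rfl | hg
      · rw [swap_apply_def]
        split_ifs with h1 h2
        · subst h1; exact Or.inr (Or.inl ⟨hR.refl _, hR.refl _⟩)
        · subst h2; exact Or.inr (Or.inr ⟨hR.refl _, hR.refl _⟩)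
        · exact hE.refl x
      · exact Or.inl ⟨g, Subgroup.subset_closure hg, rfl⟩
    | one => exact hE.refl x
    | mul g h _ _ hg hh => exact hE.trans (hh x) (hg (h x))
    | inv g _ hg => exact hE.symm (by simpa using hg (g⁻¹ x))
  · rintro (h | h | h)
    · exact hle x y h
    · exact hT.trans (hle _ _ h.1) (hT.trans hab (hle _ _ h.2))
    · exact hT.trans (hle _ _ h.1) (hT.trans (hT.symm hab) (hle _ _ h.2))

omit [DecidableEq X] in
theorem IsClasses.apply_prod_mem {r : ℕ} {t : Fin r → Perm X} {Q : Finset (Finset X)}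
    (h : IsClasses (orbitRelation t) Q) {V : Finset X} (hV : V ∈ Q) {x : X} (hx : x ∈ V) :
    (List.ofFn t).prod x ∈ V := by
  refine (h V hV x hx _).1 ⟨_, list_prod_mem fun g hg => ?_, rfl⟩
  exact Subgroup.subset_closure (List.mem_ofFn.1 hg)

theorem swap_eq_swap {a b c d : X} (hab : a ≠ b) (h : swap a b = swap c d) :
    (a = c ∧ b = d) ∨ (a = d ∧ b = c) := by
  have h1 : swap c d a = b := by rw [← h, swap_apply_left]
  rw [swap_apply_def] at h1
  split_ifs at h1 with h2 h3
  · exact Or.inl ⟨h2, h1.symm⟩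
  · exact Or.inr ⟨h3, h1.symm⟩
  · exact absurd h1 hab

variable [Fintype X]

open Classical in
/-- The factorizations of `σ` into `r` transpositions generating a group whose orbits are the
members of `Q`. -/
noncomputable def factorizations (Q : Finset (Finset X)) (σ : Perm X) (r : ℕ) :
    Finset (Fin r → Perm X) :=
  univ.filter fun t =>
    (∀ i, (t i).IsSwap) ∧ (List.ofFn t).prod = σ ∧ IsClasses (orbitRelation t) Q

theorem mem_factorizations {Q : Finset (Finset X)} {σ : Perm X} {r : ℕ} {t : Fin r → Perm X} :
    t ∈ factorizations Q σ r ↔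
      (∀ i, (t i).IsSwap) ∧ (List.ofFn t).prod = σ ∧ IsClasses (orbitRelation t) Q := by
  simp [factorizations]

theorem factorizations_eq_empty {Q : Finset (Finset X)} {σ : Perm X} {r : ℕ} {V : Finset X}
    (hV : V ∈ Q) (h : ¬σ.IsInvariant V) : factorizations Q σ r = ∅ := by
  refine eq_empty_of_forall_notMem fun t ht => h (IsInvariant.of_apply_mem fun x hx => ?_)
  obtain ⟨-, rfl, hcl⟩ := mem_factorizations.1 ht
  exact hcl.apply_prod_mem hV hx

theorem two_mul_card_factorizations_succ (Q : Finset (Finset X)) (σ : Perm X) (r : ℕ) :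
    2 * #(factorizations Q σ (r + 1)) = ∑ a, ∑ b ∈ univ.erase a,
      #((factorizations Q σ (r + 1)).filter fun t => t 0 = swap a b) := by
  rw [mul_comm, card_eq_sum_ones, sum_mul]
  simp only [card_filter]
  rw [sum_congr rfl fun a _ => sum_comm, sum_comm]
  refine sum_congr rfl fun t ht => ?_
  obtain ⟨c, d, hcd, h⟩ := (mem_factorizations.1 ht).1 0
  rw [h, one_mul, ← add_sum_erase univ _ (mem_univ c),
    ← add_sum_erase (univ.erase c) _ (mem_erase.2 ⟨hcd.symm, mem_univ d⟩),
    ← add_sum_erase (univ.erase c) _ (mem_erase.2 ⟨hcd.symm, mem_univ d⟩),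
    ← add_sum_erase (univ.erase d) _ (mem_erase.2 ⟨hcd, mem_univ c⟩), if_pos rfl,
    if_pos (swap_comm c d), sum_eq_zero, sum_eq_zero, sum_eq_zero]
  · rfl
  · intro a ha
    simp only [mem_erase] at ha
    refine sum_eq_zero fun b _ => if_neg fun e => ?_
    have := swap_eq_swap hcd e
    rcases this with h | h
    · exact ha.2.1 h.1.symm
    · exact ha.1 h.2.symm
  · intro b hb
    simp only [mem_erase] at hb
    refine if_neg fun e => ?_
    rcases swap_eq_swap hcd e with h | h
    · exact hcd h.1
    · exact hb.1 h.1.symm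
  · intro b hb
    simp only [mem_erase] at hb
    refine if_neg fun e => ?_
    rcases swap_eq_swap hcd e with h | h
    · exact hb.1 h.2.symm
    · exact hcd h.2.symm

theorem mem_factorizations_succ {Q : Finset (Finset X)} {σ : Perm X} {r : ℕ} {a b : X}
    (hab : a ≠ b) {t : Fin r → Perm X} :
    (Fin.cons (swap a b) t : Fin (r + 1) → Perm X) ∈ factorizations Q σ (r + 1) ↔
      (∀ i, (t i).IsSwap) ∧ (List.ofFn t).prod = swap a b * σ ∧
        IsClasses (mergeRel (orbitRelation t) a b) Q := by
  rw [mem_factorizations, orbitRelation_cons, Fin.forall_fin_succ, List.ofFn_cons, List.prod_cons]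
  simp only [Fin.cons_zero, Fin.cons_succ]
  have h1 : (swap a b).IsSwap := ⟨a, b, hab, rfl⟩
  have h2 : swap a b * (List.ofFn t).prod = σ ↔ (List.ofFn t).prod = swap a b * σ := by
    constructor
    · rintro rfl; rw [swap_mul_swap_mul]
    · intro h; rw [h, swap_mul_swap_mul]
  tauto

theorem card_filter_factorizations_succ {Q : Finset (Finset X)} {σ : Perm X} {r : ℕ} {a b : X}
    (hab : a ≠ b) {V : Finset X} (hQ : IsBlockPartition Q) (hV : V ∈ Q) (ha : a ∈ V) :
    #((factorizations Q σ (r + 1)).filter fun t => t 0 = swap a b) =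
      if b ∈ V then #(factorizations Q (swap a b * σ) r) + ∑ A ∈ separating V a b,
        #(factorizations (splitBlock Q V A) (swap a b * σ) r) else 0 := by
  have hcons : ∀ t : Fin (r + 1) → Perm X, t 0 = swap a b →
      Fin.cons (swap a b) (Fin.tail t) = t := fun t ht => by rw [← ht, Fin.cons_self_tail]
  split_ifs with hb
  · rw [← card_biUnion, ← card_union_of_disjoint]
    · refine (card_nbij' (fun t => Fin.cons (swap a b) t) (fun t => Fin.tail t) ?_ ?_ ?_ ?_).symm
      · intro t ht
        rw [mem_coe, mem_filter, mem_factorizations_succ hab,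
          isClasses_mergeRel_iff (equivalence_orbitRelation t) hQ hV ha hb]
        simp only [mem_coe, mem_union, mem_biUnion, mem_factorizations] at ht
        refine ⟨?_, rfl⟩
        rcases ht with ht | ⟨A, hA, ht⟩
        · exact ⟨ht.1, ht.2.1, Or.inl ht.2.2⟩
        · exact ⟨ht.1, ht.2.1, Or.inr ⟨A, hA, ht.2.2⟩⟩
      · intro t ht
        obtain ⟨ht, h0⟩ := mem_filter.1 ht
        rw [← hcons t h0, mem_factorizations_succ hab,
          isClasses_mergeRel_iff (equivalence_orbitRelation _) hQ hV ha hb] at ht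
        simp only [mem_coe, mem_union, mem_biUnion, mem_factorizations]
        obtain ⟨h1, h2, h3 | ⟨A, hA, h3⟩⟩ := ht
        · exact Or.inl ⟨h1, h2, h3⟩
        · exact Or.inr ⟨A, hA, h1, h2, h3⟩
      · intro t _
        exact Fin.tail_cons _ _
      · intro t ht
        exact hcons t (mem_filter.1 ht).2
    · rw [disjoint_left]
      intro t ht ht'
      obtain ⟨A, hA, ht'⟩ := mem_biUnion.1 ht'
      have h := IsClasses.eq_of_mem (mem_factorizations.1 ht).2.2 (mem_factorizations.1 ht').2.2 hV
        (mem_insert_self A _) ha (mem_separating.1 hA).2.1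
      exact (mem_separating.1 hA).2.2 (h ▸ hb)
    · intro A hA B hB hne
      rw [Function.onFun, disjoint_left]
      intro t ht ht'
      exact hne (IsClasses.eq_of_mem (mem_factorizations.1 ht).2.2 (mem_factorizations.1 ht').2.2
        (mem_insert_self A _) (mem_insert_self B _) (mem_separating.1 hA).2.1
        (mem_separating.1 hB).2.1)
  · refine card_eq_zero.2 (filter_eq_empty_iff.2 fun t ht h0 => ?_)
    rw [← hcons t h0, mem_factorizations_succ hab] at ht
    exact not_isClasses_mergeRel (equivalence_orbitRelation _) hV ha hb ht.2.2

theorem IsBlockPartition.sum_eq {M : Type*} [AddCommMonoid M] {Q : Finset (Finset X)}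
    (hQ : IsBlockPartition Q) (f : X → M) : ∑ x, f x = ∑ V ∈ Q, ∑ x ∈ V, f x := by
  have h : univ = Q.biUnion id := by
    ext x
    simpa using hQ.cover x
  rw [h, sum_biUnion]
  · rfl
  · intro U hU V hV hne
    rw [Function.onFun, disjoint_left]
    exact fun x hx hx' => hne (hQ.eq_of_mem U hU V hV x hx hx')

/-- The recursion obtained by removing the first transposition of a factorization. -/
theorem IsBlockPartition.two_mul_card_factorizations {Q : Finset (Finset X)}
    (hQ : IsBlockPartition Q) (σ : Perm X) (r : ℕ) :
    2 * #(factorizations Q σ (r + 1)) = ∑ V ∈ Q, ∑ a ∈ V, ∑ b ∈ V.erase a,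
      (#(factorizations Q (swap a b * σ) r) + ∑ A ∈ separating V a b,
        #(factorizations (splitBlock Q V A) (swap a b * σ) r)) := by
  rw [two_mul_card_factorizations_succ, hQ.sum_eq]
  refine sum_congr rfl fun V hV => sum_congr rfl fun a ha => ?_
  rw [sum_congr rfl fun b hb => card_filter_factorizations_succ (mem_erase.1 hb).1.symm hQ hV ha,
    ← sum_filter]
  refine sum_congr ?_ fun _ _ => rfl
  ext b
  simp

end Factorization

section Induction

open Equiv Equiv.Perm

variable {X : Type*} [DecidableEq X]

theorem notMem_splitBlock {Q : Finset (Finset X)} {V A : Finset X} {a b : X}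
    (hQ : IsBlockPartition Q) (hV : V ∈ Q) (hA : A ∈ separating V a b) (hb : b ∈ V) :
    A ∉ insert (V \ A) (Q.erase V) ∧ V \ A ∉ Q.erase V := by
  obtain ⟨hAV, haA, hbA⟩ := mem_separating.1 hA
  have key : ∀ U ∈ Q.erase V, ∀ x ∈ U, x ∉ V := fun U hU x hx hxV =>
    (mem_erase.1 hU).1 (hQ.eq_of_mem U (mem_of_mem_erase hU) V hV x hx hxV)
  refine ⟨fun h => ?_, fun h => key _ h b (mem_sdiff.2 ⟨hb, hbA⟩) hb⟩
  rcases mem_insert.1 h with h | h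
  · rw [h] at haA
    exact (mem_sdiff.1 haA).2 (h ▸ haA)
  · exact key _ h a haA (hAV haA)

variable [Fintype X]

namespace Equiv.Perm

variable {σ : Perm X} {V : Finset X} {a b : X}

theorem card_cycleSets_swap_mul_of_sameCycle (ha : a ∈ V) (hb : b ∈ V) (hab : a ≠ b)
    (h : σ.SameCycle a b) : #((swap a b * σ).cycleSets V) = #(σ.cycleSets V) + 1 := by
  have h1 := congr_arg card (erase_cycleSets_swap_mul (V := V) h)
  have ha' := cycleSet_mem_cycleSets (σ := swap a b * σ) ha
  have hb' := mem_erase.2 ⟨fun e => h.not_sameCycle_swap_mul hab (cycleSet_eq_iff.1 e.symm),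
    cycleSet_mem_cycleSets (σ := swap a b * σ) hb⟩
  have ha'' := cycleSet_mem_cycleSets (σ := σ) ha
  have h2 := card_pos.2 ⟨_, hb'⟩
  have h3 := card_pos.2 ⟨_, ha''⟩
  rw [card_erase_of_mem ha''] at h1
  rw [card_erase_of_mem hb'] at h1
  rw [card_erase_of_mem ha'] at h1 h2
  omega

theorem card_cycleSets_swap_mul_of_not_sameCycle (ha : a ∈ V) (hb : b ∈ V)
    (h : ¬σ.SameCycle a b) : #((swap a b * σ).cycleSets V) + 1 = #(σ.cycleSets V) := by
  have hab : a ≠ b := fun e => h (e ▸ SameCycle.refl σ a)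
  have := card_cycleSets_swap_mul_of_sameCycle ha hb hab (sameCycle_swap_mul h)
  rw [swap_mul_swap_mul] at this
  exact this.symm

theorem card_cycleSets_sdiff {A : Finset X} (hAV : A ⊆ V) (hA : σ.IsInvariant A) :
    #(σ.cycleSets A) + #(σ.cycleSets (V \ A)) = #(σ.cycleSets V) := by
  rw [← card_union_of_disjoint, cycleSets, cycleSets, ← image_union, union_sdiff_of_subset hAV,
    cycleSets]
  rw [disjoint_left]
  intro C hC hC'
  obtain ⟨x, hx, rfl⟩ := mem_cycleSets.1 hC
  obtain ⟨y, hy, h⟩ := mem_cycleSets.1 hC'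
  exact (mem_sdiff.1 hy).2 (hA x hx y (cycleSet_eq_iff.1 h).symm)

theorem card_cycleSets_singleton (x : X) : #(σ.cycleSets {x}) = 1 := by
  rw [cycleSets, image_singleton, card_singleton]

theorem blockWeight_singleton {x : X} (h : σ.IsInvariant {x}) : blockWeight σ {x} = 1 := by
  have h1 : σ.cycleSet x = {x} :=
    Subset.antisymm (h.cycleSet_subset (mem_singleton_self x))
      (singleton_subset_iff.2 self_mem_cycleSet)
  rw [h.blockWeight_eq, cycleSets, image_singleton, h1, familyWeight]
  simp [cycleWeight, powDivFactorial]

/-- The minimal number of transpositions in a factorization of `σ` generating a group whose orbits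
are the members of `Q`. -/
def minLength (σ : Perm X) (Q : Finset (Finset X)) : ℤ :=
  ∑ V ∈ Q, ((#V : ℤ) + #(σ.cycleSets V) - 2)

end Equiv.Perm

theorem card_factorizations_zero {Q : Finset (Finset X)} (hQ : IsBlockPartition Q) {σ : Perm X}
    (hσ : ∀ V ∈ Q, σ.IsInvariant V) :
    (#(factorizations Q σ 0) : ℚ) = if 0 = minLength σ Q then ∏ V ∈ Q, blockWeight σ V else 0 := by
  have hrel : ∀ (t : Fin 0 → Perm X) x y, orbitRelation t x y ↔ x = y := by
    intro t x y
    simp [orbitRelation, Set.range_eq_empty]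
  split_ifs with h
  · have h1 : ∀ V ∈ Q, ∃ x, V = {x} := by
      intro V hV
      have hnn : ∀ V ∈ Q, 0 ≤ (#V : ℤ) + #(σ.cycleSets V) - 2 := by
        intro V hV
        have h2 := card_pos.2 (hQ.nonempty V hV)
        have h3 := card_pos.2 ((hQ.nonempty V hV).image σ.cycleSet)
        rw [← cycleSets] at h3
        omega
      have h4 := (sum_eq_zero_iff_of_nonneg hnn).1 h.symm V hV
      have h2 := card_pos.2 (hQ.nonempty V hV)
      have h3 := card_pos.2 ((hQ.nonempty V hV).image σ.cycleSet)
      rw [← cycleSets] at h3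
      exact card_eq_one.1 (by omega)
    have h2 : σ = 1 := by
      ext x
      obtain ⟨V, hV, hx⟩ := hQ.cover x
      have hx' := (hσ V hV).apply_mem hx
      obtain ⟨y, rfl⟩ := h1 V hV
      rw [mem_singleton.1 hx', one_apply, mem_singleton.1 hx]
    have h3 : factorizations Q σ 0 = univ := by
      refine eq_univ_iff_forall.2 fun t => mem_factorizations.2 ⟨fun i => i.elim0, by simp [h2], ?_⟩
      intro V hV x hx y
      obtain ⟨z, rfl⟩ := h1 V hV
      rw [hrel, mem_singleton.1 hx, mem_singleton, eq_comm]
    rw [h3, prod_eq_one]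
    · simp
    · intro V hV
      have := hσ V hV
      obtain ⟨x, rfl⟩ := h1 V hV
      exact blockWeight_singleton this
  · rw [Nat.cast_eq_zero, card_eq_zero]
    refine eq_empty_of_forall_notMem fun t ht => h (sum_eq_zero fun V hV => ?_).symm
    obtain ⟨x, hx⟩ := hQ.nonempty V hV
    have : V = {x} := by
      ext y
      rw [← (mem_factorizations.1 ht).2.2 V hV x hx, hrel, mem_singleton, eq_comm]
    rw [this, card_cycleSets_singleton, card_singleton]
    rfl

theorem card_factorizations {r : ℕ} : ∀ {Q : Finset (Finset X)} {σ : Perm X}, IsBlockPartition Q →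
    ((∀ V ∈ Q, σ.IsInvariant V) → (r : ℤ) ≤ minLength σ Q) →
    (#(factorizations Q σ r) : ℚ) =
      if (r : ℤ) = minLength σ Q then r.factorial * ∏ V ∈ Q, blockWeight σ V else 0 := by
  induction r with
  | zero =>
    intro Q σ hQ _
    by_cases hσ : ∀ V ∈ Q, σ.IsInvariant V
    · rw [card_factorizations_zero hQ hσ]
      simp
    · push Not at hσ
      obtain ⟨V, hV, h⟩ := hσ
      rw [factorizations_eq_empty hV h, prod_eq_zero hV (blockWeight_eq_zero h)]
      simp
  | succ r ih =>
    intro Q σ hQ hr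
    by_cases hσ : ∀ V ∈ Q, σ.IsInvariant V
    swap
    · push Not at hσ
      obtain ⟨V, hV, h⟩ := hσ
      rw [factorizations_eq_empty hV h, prod_eq_zero hV (blockWeight_eq_zero h)]
      simp
    have hr := hr hσ
    have key : ∀ V ∈ Q, ∀ a ∈ V, ∀ b ∈ V.erase a,
        (#(factorizations Q (swap a b * σ) r) : ℚ) + ∑ A ∈ separating V a b,
          (#(factorizations (splitBlock Q V A) (swap a b * σ) r) : ℚ) =
        (if ((r + 1 : ℕ) : ℤ) = minLength σ Q then
          r.factorial * ∏ U ∈ Q.erase V, blockWeight σ U else 0) * (if σ.SameCycle a b then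
        ∑ A ∈ separating V a b, blockWeight (swap a b * σ) A * blockWeight (swap a b * σ) (V \ A)
          else blockWeight (swap a b * σ) V) := by
      intro V hV a ha b hb
      obtain ⟨hba, hb⟩ := mem_erase.1 hb
      have hnot : ∀ U ∈ Q.erase V, ∀ x ∈ V, x ∉ U := fun U hU x hxV hx =>
        (mem_erase.1 hU).1 (hQ.eq_of_mem U (mem_of_mem_erase hU) V hV x hx hxV)
      have hcyc : ∀ U ∈ Q.erase V, (swap a b * σ).cycleSets U = σ.cycleSets U := fun U hU =>
        (hσ U (mem_of_mem_erase hU)).cycleSets_swap_mul (hnot U hU a ha) (hnot U hU b hb)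
      have hinv : ∀ U ∈ Q.erase V, (swap a b * σ).IsInvariant U := fun U hU =>
        (hσ U (mem_of_mem_erase hU)).swap_mul_of_notMem (hnot U hU a ha) (hnot U hU b hb)
      have hwt : ∏ U ∈ Q.erase V, blockWeight (swap a b * σ) U =
          ∏ U ∈ Q.erase V, blockWeight σ U := prod_congr rfl fun U hU => by
        rw [(hinv U hU).blockWeight_eq, (hσ U (mem_of_mem_erase hU)).blockWeight_eq, hcyc U hU]
      have hsum : ∑ U ∈ Q.erase V, ((#U : ℤ) + #((swap a b * σ).cycleSets U) - 2) =
          ∑ U ∈ Q.erase V, ((#U : ℤ) + #(σ.cycleSets U) - 2) :=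
        sum_congr rfl fun U hU => by rw [hcyc U hU]
      have hlen : minLength σ Q = ((#V : ℤ) + #(σ.cycleSets V) - 2) +
          ∑ U ∈ Q.erase V, ((#U : ℤ) + #(σ.cycleSets U) - 2) :=
        (add_sum_erase Q _ hV).symm
      have hlen' : minLength (swap a b * σ) Q = ((#V : ℤ) + #((swap a b * σ).cycleSets V) - 2) +
          ∑ U ∈ Q.erase V, ((#U : ℤ) + #(σ.cycleSets U) - 2) := by
        rw [← hsum]
        exact (add_sum_erase Q _ hV).symm
      by_cases hab : σ.SameCycle a b
      · have hcard := card_cycleSets_swap_mul_of_sameCycle ha hb hba.symm hab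
        rw [if_pos hab, ih hQ fun _ => by omega, if_neg (by omega), zero_add, mul_sum]
        refine sum_congr rfl fun A hA => ?_
        obtain ⟨hA1, hA2⟩ := notMem_splitBlock hQ hV hA hb
        obtain ⟨hAV, -, -⟩ := mem_separating.1 hA
        by_cases hAinv : (swap a b * σ).IsInvariant A
        · have hlen'' : minLength (swap a b * σ) (splitBlock Q V A) = minLength σ Q - 1 := by
            rw [hlen, minLength, splitBlock, sum_insert hA1, sum_insert hA2, hsum]
            have h1 := card_cycleSets_sdiff hAV hAinv
            have h2 := card_sdiff_add_card_eq_card hAV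
            omega
          rw [ih (isBlockPartition_splitBlock hQ hV hA hb) fun _ => by omega, hlen'', splitBlock,
            prod_insert hA1, prod_insert hA2, hwt]
          have h3 : (r : ℤ) = minLength σ Q - 1 ↔ ((r + 1 : ℕ) : ℤ) = minLength σ Q := by omega
          simp only [h3]
          split_ifs <;> ring
        · rw [splitBlock, factorizations_eq_empty (mem_insert_self _ _) hAinv,
            blockWeight_eq_zero hAinv]
          simp
      · have hcard := card_cycleSets_swap_mul_of_not_sameCycle ha hb hab
        rw [if_neg hab, sum_eq_zero, ih hQ fun _ => by omega, ← mul_prod_erase Q _ hV, hwt,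
          add_zero]
        · have h3 : (r : ℤ) = minLength (swap a b * σ) Q ↔
            ((r + 1 : ℕ) : ℤ) = minLength σ Q := by omega
          simp only [h3]
          split_ifs <;> ring
        · intro A hA
          obtain ⟨-, haA, hbA⟩ := mem_separating.1 hA
          rw [splitBlock, factorizations_eq_empty (mem_insert_self _ _)
            fun h => hbA (h a haA b (sameCycle_swap_mul hab))]
          simp
    have hrec := congr_arg (Nat.cast : ℕ → ℚ) (hQ.two_mul_card_factorizations σ r)
    push_cast at hrec
    rw [sum_congr rfl fun V hV => sum_congr rfl fun a ha => sum_congr rfl (key V hV a ha)] at hrec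
    simp only [← mul_sum] at hrec
    rw [sum_congr rfl fun V hV => by
      rw [sum_blockWeight_swap_mul (hσ V hV) (hQ.nonempty V hV)]] at hrec
    split_ifs at hrec ⊢ with h
    · have hsum : ∑ V ∈ Q, r.factorial * (∏ U ∈ Q.erase V, blockWeight σ U) *
          (2 * (#V + #(σ.cycleSets V) - 2) * blockWeight σ V) =
          2 * (r.factorial * ∏ V ∈ Q, blockWeight σ V) *
            ∑ V ∈ Q, ((#V : ℚ) + #(σ.cycleSets V) - 2) := by
        rw [mul_sum]
        refine sum_congr rfl fun V hV => ?_
        rw [← mul_prod_erase Q _ hV]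
        ring
      have hr' := congr_arg (Int.cast : ℤ → ℚ) h
      rw [minLength] at hr'
      push_cast at hr'
      rw [hsum, ← hr'] at hrec
      rw [Nat.factorial_succ]
      push_cast
      linarith
    · simpa using hrec

end Induction

theorem Multiset.eq_of_filter_two_le_eq {M N : Multiset ℕ} (hM : ∀ m ∈ M, 1 ≤ m)
    (hN : ∀ m ∈ N, 1 ≤ m) (hsum : M.sum = N.sum)
    (h : M.filter (fun m => 2 ≤ m) = N.filter (fun m => 2 ≤ m)) : M = N := by
  have key : ∀ K : Multiset ℕ, (∀ m ∈ K, 1 ≤ m) → K.filter (fun m => 2 ≤ m) +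
      Multiset.replicate (card (K.filter fun m => ¬2 ≤ m)) 1 = K := fun K hK => by
    conv_rhs => rw [← Multiset.filter_add_not (fun m => 2 ≤ m) K]
    congr 1
    refine (Multiset.eq_replicate_card.2 fun m hm => ?_).symm
    have := hK m (Multiset.mem_of_mem_filter hm)
    have := (Multiset.mem_filter.1 hm).2
    omega
  rw [← key M hM, ← key N hN, h] at hsum
  rw [← key M hM, ← key N hN, h]
  simp only [Multiset.sum_add, Multiset.sum_replicate, smul_eq_mul, mul_one] at hsum
  rw [Nat.add_left_cancel hsum]

namespace Equiv.Perm

variable {X : Type*} [Fintype X] [DecidableEq X] (σ : Perm X)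

theorem image_support_cycleFactorsFinset :
    σ.cycleFactorsFinset.image support = (σ.cycleSets univ).filter fun C => 2 ≤ #C := by
  have key : ∀ x ∈ σ.support, (σ.cycleOf x).support = σ.cycleSet x := fun x hx => by
    ext y
    rw [mem_support_cycleOf_iff, mem_cycleSet, and_iff_left hx]
  ext C
  simp only [mem_image, mem_filter, mem_cycleSets, mem_univ, true_and]
  constructor
  · rintro ⟨c, hc, rfl⟩
    obtain ⟨hcyc, -⟩ := mem_cycleFactorsFinset_iff.1 hc
    obtain ⟨x, hx⟩ := hcyc.nonempty_support
    refine ⟨⟨x, ?_⟩, hcyc.two_le_card_support⟩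
    rw [← key x (mem_cycleFactorsFinset_support_le hc hx), cycle_is_cycleOf hx hc]
  · rintro ⟨⟨x, rfl⟩, hx⟩
    have hx' : x ∈ σ.support := by
      obtain ⟨y, hy, hne⟩ := exists_mem_ne hx x
      exact mem_support.2 fun h => hne ((mem_cycleSet.1 hy).eq_of_left h).symm
    exact ⟨_, cycleOf_mem_cycleFactorsFinset_iff.2 hx', key x hx'⟩

theorem injOn_support_cycleFactorsFinset :
    Set.InjOn support (σ.cycleFactorsFinset : Set (Perm X)) := by
  intro c hc c' hc' h
  obtain ⟨x, hx⟩ := (mem_cycleFactorsFinset_iff.1 hc).1.nonempty_support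
  rw [cycle_is_cycleOf hx hc, cycle_is_cycleOf (h ▸ hx : x ∈ c'.support) hc']

theorem filter_map_card_cycleSets :
    ((σ.cycleSets univ).val.map card).filter (fun m => 2 ≤ m) = σ.cycleType := by
  rw [Multiset.filter_map, cycleType_def, ← Multiset.map_map,
    ← image_val_of_injOn σ.injOn_support_cycleFactorsFinset, image_support_cycleFactorsFinset]
  rfl

theorem map_card_cycleSets {M : Multiset ℕ} (hM : ∀ m ∈ M, 1 ≤ m) (hsum : M.sum = Fintype.card X)
    (h : σ.cycleType = M.filter fun m => 2 ≤ m) : (σ.cycleSets univ).val.map card = M := by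
  refine Multiset.eq_of_filter_two_le_eq ?_ hM ?_ (σ.filter_map_card_cycleSets.trans h)
  · simp only [Multiset.mem_map]
    rintro _ ⟨C, hC, rfl⟩
    exact card_pos_of_mem_cycleSets hC
  · rw [hsum, ← card_univ]
    have : σ.IsInvariant univ := fun _ _ y _ => mem_univ y
    exact_mod_cast this.sum_card

end Equiv.Perm

open Equiv.Perm in
theorem card_factorizations_univ {X : Type*} [Fintype X] [DecidableEq X] [Nonempty X]
    (σ : Equiv.Perm X) {r : ℕ}
    (hr : (r : ℤ) = Fintype.card X + #(σ.cycleSets univ) - 2) :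
    (#(factorizations {univ} σ r) : ℚ) = r.factorial *
      ((Fintype.card X : ℚ) ^ ((#(σ.cycleSets univ) : ℤ) - 3) *
        ∏ C ∈ σ.cycleSets univ, cycleWeight #C) := by
  have hinv : σ.IsInvariant univ := fun _ _ y _ => mem_univ y
  have hQ : IsBlockPartition ({univ} : Finset (Finset X)) := by
    refine ⟨fun x => ⟨univ, by simp⟩, ?_, ?_⟩ <;> simp
  have hlen : minLength σ {univ} = r := by rw [minLength, sum_singleton, card_univ, hr]
  rw [card_factorizations hQ fun _ => hlen.ge, if_pos hlen.symm, prod_singleton,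
    hinv.blockWeight_eq, familyWeight, hinv.sum_card, card_univ]

theorem natCard_transitive_factorizations {X : Type*} [Fintype X] [DecidableEq X]
    (σ : Equiv.Perm X) (r : ℕ) :
    Nat.card {t : Fin r → Equiv.Perm X // (∀ i, (t i).IsSwap) ∧ (List.ofFn t).prod = σ ∧
      ∀ x y, ∃ g ∈ Subgroup.closure (Set.range t), g x = y} = #(factorizations {univ} σ r) := by
  rw [← Nat.card_eq_finsetCard]
  refine Nat.card_congr (Equiv.subtypeEquivRight fun t => ?_)
  simp [mem_factorizations, IsClasses, orbitRelation]

end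

/-- **Hurwitz's formula, genus 0.**
Let `α = (α_1, …, α_n)` be a partition of `d` with `n` (positive) parts, and let
`σ` be a fixed permutation of `{1,…,d}` of cycle type `α` (in Mathlib's
convention, `σ.cycleType` lists only the parts `≥ 2`).  The genus `0` single
Hurwitz number `H^0_α` counts, via monodromy, the tuples of
`r^0_α = d + n - 2` transpositions in `S_d` whose (ordered) product is `σ` and
which generate a transitive subgroup; the number `F` of such tuples satisfies
`H^0_α = F / ∏_i α_i`.  Hurwitz's formula
`H^0_α = (d - 2 + n)! · d^{n-3} · ∏_{i=1}^n (α_i^{α_i} / α_i!)`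
is therefore equivalent to the denominator-cleared identity
`F · d^3 · ∏ α_i! = (d + n - 2)! · d^n · ∏ α_i^{α_i + 1}`, formalized here. -/
theorem hurwitz_formula_genus_zero (d n : ℕ) (hd : 1 ≤ d) (hn : 1 ≤ n)
    (α : Fin n → ℕ) (hα : ∀ i, 1 ≤ α i) (hsum : ∑ i, α i = d)
    (σ : Equiv.Perm (Fin d))
    (hσ : σ.cycleType =
      Multiset.filter (fun x => 2 ≤ x) (Multiset.ofList (List.ofFn α))) :
    (Nat.card {t : Fin (d + n - 2) → Equiv.Perm (Fin d) //
        (∀ i, (t i).IsSwap) ∧ (List.ofFn t).prod = σ ∧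
        ∀ x y : Fin d, ∃ g ∈ Subgroup.closure (Set.range t), g x = y} : ℚ)
        * (d : ℚ) ^ 3 * ∏ i, ((α i).factorial : ℚ) =
      ((d + n - 2).factorial : ℚ) * (d : ℚ) ^ n *
        ∏ i, (α i : ℚ) ^ (α i + 1) := by
  have : Nonempty (Fin d) := ⟨⟨0, hd⟩⟩
  have hM : (σ.cycleSets Finset.univ).val.map Finset.card = Multiset.ofList (List.ofFn α) :=
    σ.map_card_cycleSets (by simpa [List.mem_ofFn] using hα) (by simp [List.sum_ofFn, hsum]) hσ
  have hcard : (σ.cycleSets Finset.univ).card = n := by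
    simpa using congr_arg Multiset.card hM
  have hprod : ∏ C ∈ σ.cycleSets Finset.univ, cycleWeight C.card = ∏ i, cycleWeight (α i) := by
    rw [← List.prod_ofFn, Finset.prod, ← Multiset.prod_coe, ← Function.comp_def cycleWeight α,
      ← List.map_ofFn, ← Multiset.map_coe, ← hM, Multiset.map_map]
    rfl
  have hd0 : (d : ℚ) ≠ 0 := by positivity
  rw [natCard_transitive_factorizations,
    card_factorizations_univ σ (by rw [hcard, Fintype.card_fin]; omega), hcard, hprod,
    Fintype.card_fin, zpow_sub₀ hd0, zpow_natCast]
  have hw : (∏ i, cycleWeight (α i)) * ∏ i, ((α i).factorial : ℚ) =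
      ∏ i, (α i : ℚ) ^ (α i + 1) := by
    rw [← Finset.prod_mul_distrib]
    refine Finset.prod_congr rfl fun i _ => ?_
    have := (α i).factorial_ne_zero
    rw [cycleWeight, powDivFactorial]
    field_simp
    ring
  rw [← hw, show (3 : ℤ) = ((3 : ℕ) : ℤ) from rfl, zpow_natCast]
  field_simp
end
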